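/- Let ω = (√5 − 1)/2, κ = 1.3 and ε = 0.5. Then there exists a real-analytic, 1-periodic map K : ℝ → ℝ² satisfying F(K(θ − ω), θ − ω) = K(θ) for all θ ∈ ℝ, and there exist a real-analytic, 1-periodic map P : ℝ → Matrix(2, 2, ℝ) with P(θ) invertible for every θ, and real numbers λ_s, λ_u with |λ_s| ≤ 0.3572 and |λ_u| ≥ 2.799 (in particular |λ_s| < 1 < |λ_u|), such that D_{(x,y)}F(K(θ − ω), θ − ω)·P(θ − ω) = P(θ)·diag(λ_s, λ_u) for all θ ∈ ℝ. That is, the perturbed standard map has a real-analytic fiberwise hyperbolic invariant torus with constant diagonal reduced linearized dynamics for these parameter values. -/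

import Mathlib

/-- The perturbed standard map `F : ℝ² × ℝ → ℝ²`. -/
noncomputable def stdF (κ ε : ℝ) (x y θ : ℝ) : ℝ × ℝ :=
  (x + y - κ / (2 * Real.pi) * Real.sin (2 * Real.pi * x) - ε * Real.sin (2 * Real.pi * θ),
   y - κ / (2 * Real.pi) * Real.sin (2 * Real.pi * x) - ε * Real.sin (2 * Real.pi * θ))

/-- Jacobian of `F` with respect to `(x, y)` at `(x, y, θ)`. -/
noncomputable def stdDF (κ : ℝ) (x : ℝ) : Matrix (Fin 2) (Fin 2) ℝ :=
  !![1 - κ * Real.cos (2 * Real.pi * x), 1;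
     -(κ * Real.cos (2 * Real.pi * x)), 1]

/-- Real-valued continuous functions on the circle `ℝ / ℤ`. -/
abbrev CircleFn : Type := C(UnitAddCircle, ℝ)

namespace CircleFn

open Filter Topology MeasureTheory AddCircle

/-- Translation of a function on the circle. -/
noncomputable def shift (a : UnitAddCircle) : CircleFn →L[ℝ] CircleFn where
  toFun f := f.comp ⟨fun x => x + a, by fun_prop⟩
  map_add' _ _ := rfl
  map_smul' _ _ := rfl
  cont := ContinuousMap.continuous_precomp _

@[simp] lemma shift_apply (a : UnitAddCircle) (f : CircleFn) (x : UnitAddCircle) :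
    shift a f x = f (x + a) := rfl

lemma norm_shift_apply_le (a : UnitAddCircle) (f : CircleFn) : ‖shift a f‖ ≤ ‖f‖ :=
  (ContinuousMap.norm_le _ (norm_nonneg _)).2 fun x => f.norm_coe_le_norm (x + a)

lemma norm_shift_le (a : UnitAddCircle) : ‖shift a‖ ≤ 1 :=
  ContinuousLinearMap.opNorm_le_bound _ zero_le_one fun f => by
    simpa using norm_shift_apply_le a f

/-- The translates of a fixed function depend continuously on the translation. -/
lemma continuous_shift_real (f : CircleFn) :
    Continuous fun t : ℝ => shift (t : UnitAddCircle) f := by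
  have h : Continuous fun p : ℝ × UnitAddCircle => f (p.2 + (p.1 : UnitAddCircle)) := by
    have : Continuous fun t : ℝ => (t : UnitAddCircle) := AddCircle.continuous_mk' 1
    fun_prop
  exact (ContinuousMap.curry ⟨_, h⟩).continuous

/-- A function on the circle whose orbit under translations is real-analytic. -/
def AnalyticOrbit (f : CircleFn) : Prop :=
  AnalyticAt ℝ (fun t : ℝ => shift (t : UnitAddCircle) f) 0

lemma AnalyticOrbit.analyticAt {f : CircleFn} (hf : AnalyticOrbit f) (θ : ℝ) :
    AnalyticAt ℝ (fun t : ℝ => f (t : UnitAddCircle)) θ := by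
  have h1 : AnalyticAt ℝ (fun t : ℝ => (ContinuousMap.evalCLM ℝ (θ : UnitAddCircle))
      (shift (t : UnitAddCircle) f)) 0 :=
    (ContinuousLinearMap.analyticAt _ _).comp hf
  have h2 : AnalyticAt ℝ (fun t : ℝ => t - θ) θ := analyticAt_id.sub analyticAt_const
  have h3 := AnalyticAt.comp_of_eq h1 h2 (sub_self θ)
  refine h3.congr (Eventually.of_forall fun t => ?_)
  simp

/-- Analyticity of the orbit is transported forward by equivariant analytic maps. -/
lemma AnalyticOrbit.map {f : CircleFn} (hf : AnalyticOrbit f) {G : CircleFn → CircleFn}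
    (hG : AnalyticAt ℝ G f) (hcomm : ∀ a g, G (shift a g) = shift a (G g)) :
    AnalyticOrbit (G f) := by
  have h0 : shift ((0 : ℝ) : UnitAddCircle) f = f := by ext x; simp
  exact (AnalyticAt.comp_of_eq hG hf h0).congr (Eventually.of_forall fun t => hcomm _ _)

/-- Analyticity of the orbit is transported backward by equivariant analytic maps with
invertible derivative. -/
lemma AnalyticOrbit.of_map {f : CircleFn} {G : CircleFn → CircleFn}
    (hGf : AnalyticOrbit (G f)) (hG : AnalyticAt ℝ G f)
    (hcomm : ∀ a g, G (shift a g) = shift a (G g))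
    {D : CircleFn →L[ℝ] CircleFn} (hD : HasFDerivAt G D f) (hunit : IsUnit D) :
    AnalyticOrbit f := by
  obtain ⟨v, rfl⟩ := hunit
  let i : CircleFn ≃L[ℝ] CircleFn := ContinuousLinearEquiv.unitsEquiv ℝ CircleFn v
  have hi : (i : CircleFn →L[ℝ] CircleFn) = v := by ext; rfl
  have hfd : HasStrictFDerivAt G (i : CircleFn →L[ℝ] CircleFn) f := by
    rw [hi, ← hD.fderiv]; exact hG.hasStrictFDerivAt
  let R := hfd.toOpenPartialHomeomorph G
  have hfs : f ∈ R.source := hfd.mem_toOpenPartialHomeomorph_source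
  have hR : AnalyticAt ℝ R.symm (G f) := by
    refine R.analyticAt_symm' (i := i) hfs hG ?_
    rw [hi]; exact hD.fderiv
  have h0 : ∀ g : CircleFn, shift ((0 : ℝ) : UnitAddCircle) g = g := fun g => by ext x; simp
  refine (AnalyticAt.comp_of_eq hR hGf (h0 _)).congr ?_
  have hev : ∀ᶠ t : ℝ in 𝓝 0, shift (t : UnitAddCircle) f ∈ R.source :=
    (continuous_shift_real f).continuousAt.eventually_mem
      (by simpa only [h0] using R.open_source.mem_nhds hfs)
  filter_upwards [hev] with t ht
  have h := R.left_inv ht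
  rw [show R (shift (t : UnitAddCircle) f) = G (shift (t : UnitAddCircle) f) from rfl,
    hcomm] at h
  exact h

/-- A multiplication operator bounded below by `m`, perturbed by an operator of norm smaller
than `m`, is invertible. -/
lemma isUnit_mul_sub {a : CircleFn} {m : ℝ} (ha : ∀ x, m ≤ a x)
    {B : CircleFn →L[ℝ] CircleFn} (hB : ‖B‖ < m) :
    IsUnit (ContinuousLinearMap.mul ℝ CircleFn a - B) := by
  have hm : 0 < m := (norm_nonneg B).trans_lt hB
  have hne : ∀ x, a x ≠ 0 := fun x => (hm.trans_le (ha x)).ne'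
  let b : CircleFn := ⟨fun x => (a x)⁻¹, a.continuous.inv₀ hne⟩
  have hb : ‖b‖ ≤ m⁻¹ := (ContinuousMap.norm_le _ (inv_nonneg.2 hm.le)).2 fun x => by
    have : 0 < a x := hm.trans_le (ha x)
    rw [show b x = (a x)⁻¹ from rfl, Real.norm_of_nonneg (inv_nonneg.2 this.le)]
    exact inv_anti₀ hm (ha x)
  let A := ContinuousLinearMap.mul ℝ CircleFn a
  let A' := ContinuousLinearMap.mul ℝ CircleFn b
  have h1 : A * A' = 1 := by ext f x; simp [A, A', b, hne]
  have h2 : A' * A = 1 := by ext f x; simp [A, A', b, hne]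
  have hA : IsUnit A := ⟨⟨A, A', h1, h2⟩, rfl⟩
  have hA' : ‖A'‖ ≤ m⁻¹ := (ContinuousLinearMap.opNorm_mul_apply_le ℝ CircleFn b).trans hb
  have hlt : ‖A' * B‖ < 1 := by
    calc ‖A' * B‖ ≤ ‖A'‖ * ‖B‖ := norm_mul_le _ _
      _ ≤ m⁻¹ * ‖B‖ := by gcongr
      _ < m⁻¹ * m := by gcongr
      _ = 1 := inv_mul_cancel₀ hm.ne'
  have : A - B = A * (1 - A' * B) := by rw [mul_sub, ← mul_assoc, h1]; simp
  change IsUnit (A - B)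
  rw [this]
  exact hA.mul (isUnit_one_sub_of_norm_lt_one (x := A' * B) hlt)

/-- Pointwise sine. -/
noncomputable def sinFn (f : CircleFn) : CircleFn := ⟨fun x => Real.sin (f x), by fun_prop⟩

/-- Pointwise cosine. -/
noncomputable def cosFn (f : CircleFn) : CircleFn := ⟨fun x => Real.cos (f x), by fun_prop⟩

@[simp] lemma sinFn_apply (f : CircleFn) (x : UnitAddCircle) : sinFn f x = Real.sin (f x) := rfl

@[simp] lemma cosFn_apply (f : CircleFn) (x : UnitAddCircle) : cosFn f x = Real.cos (f x) := rfl

lemma exp_apply (f : CircleFn) (x : UnitAddCircle) :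
    NormedSpace.exp f x = Real.exp (f x) := by
  rw [Real.exp_eq_exp_ℝ]
  exact NormedSpace.map_exp (ContinuousMap.evalAlgHom ℝ ℝ x)
    (continuous_eval_const x) f

lemma complex_exp_apply (f : C(UnitAddCircle, ℂ)) (x : UnitAddCircle) :
    NormedSpace.exp f x = Complex.exp (f x) := by
  rw [Complex.exp_eq_exp_ℂ]
  exact NormedSpace.map_exp (ContinuousMap.evalAlgHom ℂ ℂ x)
    (continuous_eval_const x) f

/-- The map `f ↦ i f` into complex-valued functions. -/
noncomputable def mulICLM : CircleFn →L[ℝ] C(UnitAddCircle, ℂ) :=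
  ContinuousLinearMap.compLeftContinuous ℝ UnitAddCircle (Complex.I • Complex.ofRealCLM)

lemma mulICLM_apply (f : CircleFn) (x : UnitAddCircle) : mulICLM f x = Complex.I * f x := rfl

lemma sinFn_eq : sinFn = fun f =>
    ContinuousLinearMap.compLeftContinuous ℝ UnitAddCircle Complex.imCLM
      (NormedSpace.exp (mulICLM f)) := by
  funext f; ext x
  change Real.sin (f x) = (NormedSpace.exp (mulICLM f) x).im
  rw [complex_exp_apply, mulICLM_apply, mul_comm, Complex.exp_ofReal_mul_I_im]

lemma cosFn_eq : cosFn = fun f =>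
    ContinuousLinearMap.compLeftContinuous ℝ UnitAddCircle Complex.reCLM
      (NormedSpace.exp (mulICLM f)) := by
  funext f; ext x
  change Real.cos (f x) = (NormedSpace.exp (mulICLM f) x).re
  rw [complex_exp_apply, mulICLM_apply, mul_comm, Complex.exp_ofReal_mul_I_re]

lemma analyticAt_exp_mulI (f : CircleFn) :
    AnalyticAt ℝ (fun g : CircleFn => NormedSpace.exp (mulICLM g)) f :=
  (NormedSpace.exp_analytic (𝕂 := ℝ) (mulICLM f)).comp (mulICLM.analyticAt f)

lemma analyticAt_sinFn (f : CircleFn) : AnalyticAt ℝ sinFn f := by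
  rw [sinFn_eq]
  exact (ContinuousLinearMap.analyticAt _ _).comp (analyticAt_exp_mulI f)

lemma analyticAt_cosFn (f : CircleFn) : AnalyticAt ℝ cosFn f := by
  rw [cosFn_eq]
  exact (ContinuousLinearMap.analyticAt _ _).comp (analyticAt_exp_mulI f)

lemma hasFDerivAt_sinFn (f : CircleFn) :
    HasFDerivAt sinFn (ContinuousLinearMap.mul ℝ CircleFn (cosFn f)) f := by
  rw [sinFn_eq]
  have h := (ContinuousLinearMap.compLeftContinuous ℝ UnitAddCircle
    Complex.imCLM).hasFDerivAt.comp f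
    ((hasFDerivAt_exp (𝕂 := ℝ) (x := mulICLM f)).comp f mulICLM.hasFDerivAt)
  refine h.congr_fderiv ?_
  ext g x
  change (NormedSpace.exp (mulICLM f) x * mulICLM g x).im = Real.cos (f x) * g x
  rw [complex_exp_apply, mulICLM_apply, mulICLM_apply, mul_comm Complex.I, Complex.exp_mul_I,
    ← Complex.ofReal_cos, ← Complex.ofReal_sin]
  simp [Complex.mul_im, Complex.cos_ofReal_re]

/-- Functions satisfying a hyperbolic second-order difference equation with sine nonlinearity and
forcing with analytic orbit have analytic orbit. -/
lemma AnalyticOrbit.of_sine_equation {U g : CircleFn} {κ δ : ℝ} {a : UnitAddCircle}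
    (hδ : 0 < δ) (hU : ∀ x, δ ≤ κ * Real.cos (U x)) (hg : AnalyticOrbit g)
    (heq : ∀ x, U (x + a) + U (x - a) - 2 * U x - κ * Real.sin (U x) = g x) :
    AnalyticOrbit U := by
  let S : CircleFn →L[ℝ] CircleFn :=
    shift a + shift (-a) - (2 : ℝ) • ContinuousLinearMap.id ℝ CircleFn
  let G : CircleFn → CircleFn := fun f => S f - κ • sinFn f
  have hGU : G U = g := by
    ext x
    simpa [G, S, sub_eq_add_neg] using heq x
  have hcomm : ∀ b f, G (shift b f) = shift b (G f) := by
    intro b f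
    ext x
    simp [G, S, add_right_comm]
  have hA : AnalyticAt ℝ G U :=
    (S.analyticAt U).sub ((analyticAt_const (v := κ)).fun_smul (analyticAt_sinFn U))
  have hD : HasFDerivAt G (S - κ • ContinuousLinearMap.mul ℝ CircleFn (cosFn U)) U :=
    S.hasFDerivAt.sub ((hasFDerivAt_sinFn U).const_smul κ)
  refine AnalyticOrbit.of_map (hGU ▸ hg) hA hcomm hD ?_
  have hB : ‖shift a + shift (-a)‖ < 2 + δ := by
    have := norm_add_le (shift a) (shift (-a))
    have := norm_shift_le a
    have := norm_shift_le (-a)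
    linarith
  have hu := isUnit_mul_sub (a := .const _ 2 + κ • cosFn U) (m := 2 + δ)
    (fun x => by simpa using hU x) hB
  convert hu.neg using 1
  ext f x
  simp [S]
  ring

/-- The logarithm of a solution of a Riccati equation with coefficient having analytic orbit has
analytic orbit. -/
lemma AnalyticOrbit.of_riccati {l d : CircleFn} {a : UnitAddCircle}
    (hl : ∀ x, 2 ≤ Real.exp (l x)) (hd : AnalyticOrbit d)
    (heq : ∀ x, Real.exp (l x) + Real.exp (-l (x - a)) = d x) :
    AnalyticOrbit l := by
  let G : CircleFn → CircleFn := fun f => NormedSpace.exp f + NormedSpace.exp (-shift (-a) f)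
  have hGl : G l = d := by
    ext x
    simpa [G, exp_apply, sub_eq_add_neg] using heq x
  have hcomm : ∀ b f, G (shift b f) = shift b (G f) := by
    intro b f
    ext x
    simp [G, exp_apply, add_right_comm]
  have hA : AnalyticAt ℝ G l :=
    (NormedSpace.exp_analytic l).add
      (AnalyticAt.comp (NormedSpace.exp_analytic (𝕂 := ℝ) (-shift (-a) l))
        ((-shift (-a)).analyticAt l))
  let E : CircleFn := NormedSpace.exp (-shift (-a) l)
  let B : CircleFn →L[ℝ] CircleFn := ContinuousLinearMap.mul ℝ CircleFn E ∘L shift (-a)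
  have hD : HasFDerivAt G (ContinuousLinearMap.mul ℝ CircleFn (NormedSpace.exp l) - B) l := by
    have h := (hasFDerivAt_exp (𝕂 := ℝ) (x := l)).add
      (HasFDerivAt.comp l (hasFDerivAt_exp (𝕂 := ℝ) (x := -shift (-a) l))
        ((-shift (-a)).hasFDerivAt))
    refine h.congr_fderiv ?_
    ext f x
    simp [B, E, sub_eq_add_neg]
  refine AnalyticOrbit.of_map (hGl ▸ hd) hA hcomm hD (isUnit_mul_sub (m := 2) ?_ ?_)
  · intro x
    rw [exp_apply]
    exact hl x
  · have hE : ‖E‖ ≤ 1 := (ContinuousMap.norm_le _ zero_le_one).2 fun x => by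
      rw [exp_apply, Real.norm_of_nonneg (Real.exp_pos _).le]
      have := hl (x + -a)
      simp only [ContinuousMap.neg_apply, shift_apply, Real.exp_neg]
      exact inv_le_one_of_one_le₀ (by linarith)
    have h1 := ContinuousLinearMap.opNorm_comp_le (ContinuousLinearMap.mul ℝ CircleFn E)
      (shift (-a))
    have h2 := ContinuousLinearMap.opNorm_mul_apply_le ℝ CircleFn E
    have h3 := norm_shift_le (-a)
    have h4 : ‖ContinuousLinearMap.mul ℝ CircleFn E‖ * ‖shift (-a)‖ ≤ 1 * 1 := by
      gcongr
      exact h2.trans hE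
    exact (h1.trans h4).trans_lt (by norm_num)

/-- The `k`-th Fourier coefficient as a continuous linear functional. -/
noncomputable def coeffCLM (k : ℤ) : CircleFn →L[ℝ] ℂ :=
  LinearMap.mkContinuous
    { toFun := fun f => fourierCoeff (fun x => (f x : ℂ)) k
      map_add' := fun f g => by
        have hi : ∀ h : CircleFn, Integrable (fun x => (h x : ℂ)) haarAddCircle := fun h =>
          (Complex.continuous_ofReal.comp h.continuous).integrable_of_hasCompactSupport
            (HasCompactSupport.of_compactSpace _)
        simpa [Pi.add_def] using congrFun (fourierCoeff.add (hi f) (hi g)) k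
      map_smul' := fun c f => by
        simpa using fourierCoeff.const_mul (fun x => (f x : ℂ)) (c : ℂ) k } 1 fun f => by
    rw [one_mul]
    refine (norm_integral_le_of_norm_le_const (C := ‖f‖) (ae_of_all _ fun x => ?_)).trans
      (by simp)
    rw [norm_smul, fourier_apply, Circle.norm_coe, one_mul, Complex.norm_real]
    exact f.norm_coe_le_norm x

lemma coeffCLM_apply (k : ℤ) (f : CircleFn) :
    coeffCLM k f = fourierCoeff (fun x => (f x : ℂ)) k := rfl

lemma norm_coeffCLM_le (k : ℤ) : ‖coeffCLM k‖ ≤ 1 :=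
  LinearMap.mkContinuous_norm_le _ zero_le_one _

lemma coeffCLM_shift (k : ℤ) (a : UnitAddCircle) (f : CircleFn) :
    coeffCLM k (shift a f) = fourier k a * coeffCLM k f := by
  rw [coeffCLM_apply, coeffCLM_apply, fourierCoeff, fourierCoeff, ← integral_const_mul,
    ← integral_add_right_eq_self (fun x => fourier k a * (fourier (-k) x • (f x : ℂ))) a]
  refine integral_congr_ae (ae_of_all _ fun x => ?_)
  simp only [shift_apply, smul_eq_mul, ← mul_assoc]
  congr 1
  simp only [fourier_apply, smul_add, toCircle_add, Circle.coe_mul, neg_smul, toCircle_neg,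
    Circle.coe_inv]
  field_simp

lemma iteratedDeriv_cexp_real (a c : ℂ) (n : ℕ) :
    iteratedDeriv n (fun t : ℝ => Complex.exp (a * t) * c) =
      fun t : ℝ => a ^ n * (Complex.exp (a * t) * c) := by
  induction n with
  | zero => simp
  | succ n ih =>
    rw [iteratedDeriv_succ, ih]
    funext t
    have h : HasDerivAt (fun t : ℝ => Complex.exp (a * t)) (Complex.exp (a * t) * (a * 1)) t :=
      ((Complex.ofRealCLM.hasDerivAt (x := t)).const_mul a).cexp
    rw [((h.mul_const c).const_mul (a ^ n)).deriv]
    ring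

lemma exp_mul_le_of_pow_mul_le {x y C r : ℝ} (hr : 0 < r)
    (h : ∀ n : ℕ, x ^ n * y ≤ n.factorial * (C * r ^ n)) :
    Real.exp (x * (2 * r)⁻¹) * y ≤ C * 2 := by
  have hsum := (Real.summable_pow_div_factorial (x * (2 * r)⁻¹)).mul_right y
  have h2 : C * 2 = ∑' n : ℕ, C * (1 / 2 : ℝ) ^ n := by rw [tsum_mul_left, tsum_geometric_two]
  rw [h2, Real.exp_eq_exp_ℝ, NormedSpace.exp_eq_tsum_div, ← tsum_mul_right]
  refine Summable.tsum_le_tsum (fun n => ?_) hsum (summable_geometric_two.mul_left C)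
  have hf : (0 : ℝ) < n.factorial := by positivity
  rw [mul_pow, inv_pow, mul_pow, one_div, inv_pow]
  field_simp
  linarith [h n]

/-- The Fourier coefficients of a function with analytic orbit decay exponentially. -/
lemma AnalyticOrbit.exists_coeff_bound {f : CircleFn} (hf : AnalyticOrbit f) :
    ∃ C s : ℝ, 0 < s ∧ ∀ k : ℤ, ‖coeffCLM k f‖ ≤ C * Real.exp (-(2 * Real.pi * s * |(k : ℝ)|)) := by
  obtain ⟨p, hp⟩ := hf
  obtain ⟨C, r, hC, hr, hpn⟩ := p.le_mul_pow_of_radius_pos hp.radius_pos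
  refine ⟨C * 2, (2 * r)⁻¹, by positivity, fun k => ?_⟩
  obtain ⟨R, hR⟩ := hp
  set c := coeffCLM k f
  set a : ℂ := 2 * Real.pi * Complex.I * k
  have hfun : (coeffCLM k ∘ fun t : ℝ => shift (t : UnitAddCircle) f) =
      fun t : ℝ => Complex.exp (a * t) * c := by
    funext t
    simp only [Function.comp_apply, coeffCLM_shift, fourier_coe_apply]
    simp [a, c]
  have hcoef : ∀ n : ℕ, ‖a‖ ^ n * ‖c‖ ≤ n.factorial * (C * r ^ n) := by
    intro n
    have h1 := ((coeffCLM k).comp_hasFPowerSeriesOnBall hR).factorial_smul (1 : ℝ) n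
    rw [hfun, ← iteratedDeriv_eq_iteratedFDeriv, iteratedDeriv_cexp_real] at h1
    have h2 : ‖coeffCLM k (p n fun _ => 1)‖ ≤ C * r ^ n := by
      refine ((coeffCLM k).le_of_opNorm_le (norm_coeffCLM_le k) _).trans ?_
      rw [one_mul]
      refine ((p n).le_opNorm _).trans ?_
      simpa using hpn n
    have h3 : a ^ n * c = (n.factorial : ℂ) * coeffCLM k (p n fun _ => 1) := by
      simpa using h1.symm
    rw [← norm_pow, ← norm_mul, h3, norm_mul, Complex.norm_natCast]
    gcongr
  have ha : ‖a‖ = 2 * Real.pi * |(k : ℝ)| := by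
    simp [a, abs_of_pos Real.pi_pos]
  have hle := exp_mul_le_of_pow_mul_le hr hcoef
  rw [show 2 * Real.pi * (2 * r)⁻¹ * |(k : ℝ)| = ‖a‖ * (2 * r)⁻¹ by rw [ha]; ring, Real.exp_neg,
    ← div_eq_mul_inv, le_div_iff₀ (Real.exp_pos _), mul_comm]
  exact hle

lemma summable_exp_neg_mul_abs_int {σ : ℝ} (hσ : 0 < σ) :
    Summable fun k : ℤ => Real.exp (-(σ * |(k : ℝ)|)) := by
  have h : Summable fun n : ℕ => Real.exp (-(σ * n)) := by
    refine (summable_geometric_of_lt_one (Real.exp_pos (-σ)).le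
      (by simpa using hσ)).congr fun n => ?_
    rw [← Real.exp_nat_mul]
    ring_nf
  refine Summable.of_nat_of_neg ?_ ?_ <;> simpa using h

/-- A trigonometric series with exponentially decaying coefficients is real-analytic. -/
lemma analyticAt_trig_series {b : ℤ → ℂ} {C σ : ℝ} (hσ : 0 < σ)
    (hb : ∀ k, ‖b k‖ ≤ C * Real.exp (-(2 * σ * |(k : ℝ)|))) (θ : ℝ) :
    AnalyticAt ℝ (fun t : ℝ => ∑' k : ℤ, b k * Complex.exp (2 * Real.pi * Complex.I * k * t))
      θ := by
  let U : Set ℂ := {z | |z.im| < σ / (2 * Real.pi)}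
  have hU : IsOpen U := isOpen_lt (continuous_abs.comp Complex.continuous_im) continuous_const
  have hd : DifferentiableOn ℂ
      (fun z : ℂ => ∑' k : ℤ, b k * Complex.exp (2 * Real.pi * Complex.I * k * z)) U := by
    refine Complex.differentiableOn_tsum_of_summable_norm
      ((summable_exp_neg_mul_abs_int hσ).mul_left C) (fun k => ?_) hU fun k z hz => ?_
    · exact Differentiable.differentiableOn (by fun_prop)
    · rw [norm_mul, Complex.norm_exp]
      have hre : (2 * Real.pi * Complex.I * k * z).re = -(2 * Real.pi * k * z.im) := by
        simp [Complex.mul_re, Complex.mul_im]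
      have hz' : 2 * Real.pi * |z.im| ≤ σ := by
        have := (lt_div_iff₀ (by positivity)).1 (show |z.im| < σ / (2 * Real.pi) from hz)
        linarith
      have hle : -(2 * Real.pi * k * z.im) ≤ σ * |(k : ℝ)| := by
        calc -(2 * Real.pi * k * z.im) ≤ |2 * Real.pi * k * z.im| := neg_le_abs _
          _ = 2 * Real.pi * |z.im| * |(k : ℝ)| := by
            rw [abs_mul, abs_mul, abs_of_pos (by positivity : 0 < 2 * Real.pi)]; ring
          _ ≤ σ * |(k : ℝ)| := by gcongr
      have hC : 0 ≤ C * Real.exp (-(2 * σ * |(k : ℝ)|)) := (norm_nonneg _).trans (hb k)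
      calc ‖b k‖ * Real.exp (2 * Real.pi * Complex.I * k * z).re
          ≤ C * Real.exp (-(2 * σ * |(k : ℝ)|)) * Real.exp (σ * |(k : ℝ)|) := by
            rw [hre]
            gcongr
            exact hb k
        _ = C * Real.exp (-(σ * |(k : ℝ)|)) := by
            rw [mul_assoc, ← Real.exp_add]
            ring_nf
  have hθ : (θ : ℂ) ∈ U := by
    simp only [U, Set.mem_ofPred_eq, Complex.ofReal_im, abs_zero]
    positivity
  have hz := (hd.analyticAt (hU.mem_nhds hθ)).restrictScalars (𝕜 := ℝ)
  exact hz.comp (Complex.ofRealCLM.analyticAt θ)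

lemma fourier_coe_real (k : ℤ) (t : ℝ) :
    fourier k (t : UnitAddCircle) = Complex.exp (2 * Real.pi * Complex.I * k * t) := by
  rw [fourier_coe_apply]
  simp

/-- Solution of the cohomological equation over a rotation with linearly bounded small
divisors. -/
lemma AnalyticOrbit.exists_cohomology {l : CircleFn} (hl : AnalyticOrbit l) {ω M : ℝ}
    (hω : ∀ k : ℤ, k ≠ 0 → fourier k (ω : UnitAddCircle) ≠ 1 ∧
      ‖(fourier k (ω : UnitAddCircle) - 1)⁻¹‖ ≤ M * |(k : ℝ)|) :
    ∃ w : ℝ → ℝ, (∀ θ, AnalyticAt ℝ w θ) ∧ Function.Periodic w 1 ∧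
      ∀ θ : ℝ, w (θ + ω) - w θ = l (θ : UnitAddCircle) - ∫ x, l x ∂haarAddCircle := by
  obtain ⟨C, s, hs, hC⟩ := hl.exists_coeff_bound
  set σ := Real.pi * s / 2 with hσdef
  have hσ : 0 < σ := by positivity
  have hM : 0 ≤ M := by simpa using (norm_nonneg _).trans (hω 1 one_ne_zero).2
  let c : ℤ → ℂ := fun k => coeffCLM k l
  let b : ℤ → ℂ := fun k => if k = 0 then 0 else c k * (fourier k (ω : UnitAddCircle) - 1)⁻¹
  have hC0 : 0 ≤ C := by simpa using (norm_nonneg _).trans (hC 0)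
  have hb : ∀ k, ‖b k‖ ≤ C * M * σ⁻¹ * Real.exp (-(2 * σ * |(k : ℝ)|)) := by
    intro k
    by_cases hk : k = 0
    · simp only [b, hk, if_true, norm_zero]
      positivity
    · simp only [b, hk, if_false, norm_mul]
      have h1 : |(k : ℝ)| ≤ σ⁻¹ * Real.exp (2 * σ * |(k : ℝ)|) := by
        rw [← div_eq_inv_mul, le_div_iff₀ hσ]
        have := Real.add_one_le_exp (2 * σ * |(k : ℝ)|)
        nlinarith [mul_nonneg hσ.le (abs_nonneg (k : ℝ))]
      calc ‖c k‖ * ‖(fourier k (ω : UnitAddCircle) - 1)⁻¹‖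
          ≤ (C * Real.exp (-(2 * Real.pi * s * |(k : ℝ)|))) *
            (M * (σ⁻¹ * Real.exp (2 * σ * |(k : ℝ)|))) := by
            gcongr
            · exact hC k
            · exact (hω k hk).2.trans (by gcongr)
        _ = C * M * σ⁻¹ * (Real.exp (-(2 * Real.pi * s * |(k : ℝ)|)) *
              Real.exp (2 * σ * |(k : ℝ)|)) := by ring
        _ = _ := by rw [← Real.exp_add]; congr 2; simp only [hσdef]; ring
  have hbs : Summable fun k => ‖b k‖ :=
    Summable.of_nonneg_of_le (fun _ => norm_nonneg _) hb
      ((summable_exp_neg_mul_abs_int (mul_pos two_pos hσ)).mul_left _)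
  let W : ℝ → ℂ := fun t => ∑' k : ℤ, b k * fourier k (t : UnitAddCircle)
  have hnorm : ∀ (k : ℤ) (x : UnitAddCircle), ‖fourier k x‖ = 1 := fun k x => by
    rw [fourier_apply, Circle.norm_coe]
  have hWs : ∀ t : ℝ, Summable fun k => b k * fourier k (t : UnitAddCircle) := fun t =>
    Summable.of_norm (by simpa only [norm_mul, hnorm, mul_one] using hbs)
  have hWa : ∀ θ, AnalyticAt ℝ W θ := fun θ => by
    simpa only [W, fourier_coe_real] using analyticAt_trig_series hσ hb θ
  have hcs : Summable c := by
    refine Summable.of_norm (Summable.of_nonneg_of_le (fun _ => norm_nonneg _) hC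
      ((summable_exp_neg_mul_abs_int (by positivity)).mul_left _))
  let lc : C(UnitAddCircle, ℂ) := ⟨fun x => (l x : ℂ), by fun_prop⟩
  have hsum : ∀ x, HasSum (fun k => c k * fourier k x) (l x : ℂ) := fun x =>
    has_pointwise_sum_fourier_series_of_summable (f := lc) hcs x
  have hc0 : c 0 = ((∫ x, l x ∂haarAddCircle : ℝ) : ℂ) := by
    simp only [c, coeffCLM_apply, fourierCoeff]
    simpa using integral_ofReal (𝕜 := ℂ) (f := fun x => l x) (μ := haarAddCircle)
  have hWeq : ∀ θ : ℝ, W (θ + ω) - W θ = l (θ : UnitAddCircle) - c 0 := by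
    intro θ
    have h1 := (hWs (θ + ω)).hasSum.sub (hWs θ).hasSum
    have h2 := (hsum θ).sub (hasSum_ite_eq (0 : ℤ) (c 0))
    refine h1.unique (h2.congr_fun fun k => ?_)
    by_cases hk : k = 0
    · simp [b, hk]
    · have hne := sub_ne_zero.2 (hω k hk).1
      have hadd : fourier k ((θ + ω : ℝ) : UnitAddCircle) =
          fourier k (θ : UnitAddCircle) * fourier k (ω : UnitAddCircle) := by
        simp only [fourier_coe_real, ← Complex.exp_add]
        push_cast
        ring_nf
      simp only [b, hk, if_false, hadd]
      field_simp
      ring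
  refine ⟨fun t => (W t).re, fun θ => (Complex.reCLM.analyticAt _).comp (hWa θ), fun t => ?_,
    fun θ => ?_⟩
  · simp only [W, AddCircle.coe_add_period]
  · have := congrArg Complex.re (hWeq θ)
    rw [hc0] at this
    simpa using this

/-- Existence of a solution of a Riccati equation above a given subsolution. -/
lemma exists_riccati {d q : CircleFn} {a : UnitAddCircle} (hq : ∀ x, 2 ≤ q x)
    (hsub : ∀ x, q x ≤ d x - (q (x - a))⁻¹) :
    ∃ r : CircleFn, (∀ x, q x ≤ r x) ∧ ∀ x, r x = d x - (r (x - a))⁻¹ := by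
  have hmax : ∀ (f : CircleFn) x, max 2 (f x) ≠ 0 := fun f x =>
    (two_pos.trans_le (le_max_left _ _)).ne'
  let Φ : CircleFn → CircleFn := fun f => d - ⟨fun x => (max 2 (f (x - a)))⁻¹,
    ((continuous_const.max (f.continuous.comp (continuous_id.sub continuous_const))).inv₀
      fun x => hmax f (x - a))⟩
  have hΦ : ∀ f x, Φ f x = d x - (max 2 (f (x - a)))⁻¹ := fun f x => rfl
  have hlip : LipschitzWith (1 / 4) Φ := by
    refine LipschitzWith.of_dist_le_mul fun f g => ?_
    rw [ContinuousMap.dist_le (by positivity)]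
    intro x
    rw [hΦ, hΦ, Real.dist_eq]
    have hfg : |f (x - a) - g (x - a)| ≤ dist f g := by
      simpa [Real.dist_eq] using ContinuousMap.dist_apply_le_dist (f := f) (g := g) (x - a)
    set A := max 2 (f (x - a))
    set B := max 2 (g (x - a))
    have hA : 2 ≤ A := le_max_left _ _
    have hB : 2 ≤ B := le_max_left _ _
    have hAB : |A - B| ≤ dist f g :=
      by
      simp only [A, B, max_comm (2 : ℝ)]
      exact (abs_max_sub_max_le_abs _ _ _).trans hfg
    have h1 : d x - A⁻¹ - (d x - B⁻¹) = (A - B) * (A * B)⁻¹ := by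
      have : A ≠ 0 := by positivity
      have : B ≠ 0 := by positivity
      field_simp
      ring
    have h2 : (A * B)⁻¹ ≤ 1 / 4 := by
      rw [one_div]
      exact inv_anti₀ (by norm_num) (by nlinarith)
    have h3 : 0 ≤ (A * B)⁻¹ := by positivity
    rw [h1, abs_mul, abs_of_nonneg h3]
    calc |A - B| * (A * B)⁻¹ ≤ dist f g * (1 / 4) := by gcongr
      _ = _ := by rw [mul_comm]; norm_num
  let S : Set CircleFn := {f | ∀ x, q x ≤ f x}
  have hS : IsClosed S := by
    have : S = ⋂ x, {f : CircleFn | q x ≤ f x} := by ext; simp [S]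
    rw [this]
    exact isClosed_iInter fun x =>
      isClosed_le continuous_const (continuous_eval_const x)
  have hmaps : Set.MapsTo Φ S S := fun f hf x => by
    rw [hΦ]
    have h1 := hsub x
    have h2 := hf (x - a)
    have h3 := hq (x - a)
    have h4 : (max 2 (f (x - a)))⁻¹ ≤ (q (x - a))⁻¹ :=
      inv_anti₀ (by linarith) (h2.trans (le_max_right _ _))
    linarith
  have hcontr : ContractingWith (1 / 4) (hmaps.restrict Φ S S) :=
    ⟨by rw [← NNReal.coe_lt_coe]; norm_num,
      fun f g => hlip f.1 g.1⟩
  obtain ⟨r, hrS, hr, -⟩ := hcontr.exists_fixedPoint' hS.isComplete hmaps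
    (x := q) (fun x => le_rfl) (edist_ne_top _ _)
  refine ⟨r, hrS, fun x => ?_⟩
  have h := congrArg (fun f : CircleFn => f x) hr.symm
  simp only [hΦ] at h
  rwa [max_eq_right ((hq _).trans (hrS _))] at h

/-- Positive analytic Floquet solutions of a scalar second-order quasi-periodic difference
equation, with a multiplier bounded below by that of a subsolution. -/
lemma exists_floquet {d φ : CircleFn} (hd : AnalyticOrbit d) {ω μ M : ℝ}
    (hω : ∀ k : ℤ, k ≠ 0 → fourier k (ω : UnitAddCircle) ≠ 1 ∧
      ‖(fourier k (ω : UnitAddCircle) - 1)⁻¹‖ ≤ M * |(k : ℝ)|)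
    (hμ : 0 < μ) (hφ : ∀ x, 0 < φ x) (hφ2 : ∀ x, 2 * φ x ≤ μ * φ (x + ω))
    (hsub : ∀ x, μ * φ (x + ω) + μ⁻¹ * φ (x - ω) ≤ d x * φ x) :
    ∃ (ψ : ℝ → ℝ) (lam : ℝ), μ ≤ lam ∧ (∀ θ, AnalyticAt ℝ ψ θ) ∧ Function.Periodic ψ 1 ∧
      (∀ θ, 0 < ψ θ) ∧ (∀ θ, 2 * ψ θ ≤ lam * ψ (θ + ω)) ∧
      ∀ θ : ℝ, lam * ψ (θ + ω) + lam⁻¹ * ψ (θ - ω) = d (θ : UnitAddCircle) * ψ θ := by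
  let a : UnitAddCircle := ω
  let lφ : CircleFn := ⟨fun x => Real.log (φ x), φ.continuous.log fun x => (hφ x).ne'⟩
  let q : CircleFn := ⟨fun x => μ * φ (x + a) / φ x,
    (continuous_const.mul (φ.continuous.comp (continuous_id.add continuous_const))).div
      φ.continuous fun x => (hφ x).ne'⟩
  have hqx : ∀ x, q x = μ * φ (x + a) / φ x := fun x => rfl
  obtain ⟨r, hqr, hr⟩ := exists_riccati (d := d) (q := q) (a := a)
    (fun x => by rw [hqx, le_div_iff₀ (hφ x)]; exact hφ2 x)
    (fun x => by
      have h1 := hφ x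
      have h2 := hφ (x - a)
      rw [hqx, hqx, sub_add_cancel, div_le_iff₀ h1, inv_div, sub_mul]
      have h3 : φ (x - a) / (μ * φ x) * φ x = μ⁻¹ * φ (x - a) := by field_simp
      rw [h3]
      linarith [hsub x])
  have hr2 : ∀ x, 2 ≤ r x := fun x => by
    refine le_trans ?_ (hqr x)
    rw [hqx, le_div_iff₀ (hφ x)]
    exact hφ2 x
  have hr0 : ∀ x, 0 < r x := fun x => two_pos.trans_le (hr2 x)
  let l : CircleFn := ⟨fun x => Real.log (r x), r.continuous.log fun x => (hr0 x).ne'⟩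
  have hexp : ∀ x, Real.exp (l x) = r x := fun x => Real.exp_log (hr0 x)
  have hl : AnalyticOrbit l := AnalyticOrbit.of_riccati (a := a)
    (fun x => (hr2 x).trans_eq (hexp x).symm) hd fun x => by
      rw [Real.exp_neg, hexp, hexp, hr x]
      ring
  obtain ⟨w, hwa, hwp, hw⟩ := hl.exists_cohomology hω
  set m := ∫ x, l x ∂haarAddCircle
  have hint : ∀ f : CircleFn, Integrable (fun x => f x) haarAddCircle := fun f =>
    f.continuous.integrable_of_hasCompactSupport (HasCompactSupport.of_compactSpace _)
  have hm : Real.log μ ≤ m := by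
    have hi : Integrable (fun x => Real.log μ + shift a lφ x) haarAddCircle :=
      (integrable_const _).add (hint (shift a lφ))
    have h1 : ∫ x, (Real.log μ + shift a lφ x - lφ x) ∂haarAddCircle = Real.log μ := by
      rw [integral_sub hi (hint lφ),
        integral_add (integrable_const _) (hint (shift a lφ))]
      simp only [shift_apply]
      rw [integral_add_right_eq_self (fun x => lφ x) a]
      simp
    rw [← h1]
    refine integral_mono (hi.sub (hint lφ)) (hint l)
      fun x => ?_
    have h2 : Real.log μ + shift a lφ x - lφ x = Real.log (q x) := by
      rw [hqx, Real.log_div (mul_pos hμ (hφ _)).ne' (hφ x).ne', Real.log_mul hμ.ne' (hφ _).ne']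
      rfl
    change Real.log μ + shift a lφ x - lφ x ≤ Real.log (r x)
    rw [h2]
    exact Real.log_le_log (div_pos (mul_pos hμ (hφ _)) (hφ x)) (hqr x)
  have hstep : ∀ θ : ℝ, Real.exp m * Real.exp (w (θ + ω)) =
      r (θ : UnitAddCircle) * Real.exp (w θ) := fun θ => by
    rw [← hexp, ← Real.exp_add, ← Real.exp_add]
    congr 1
    linarith [hw θ]
  refine ⟨fun θ => Real.exp (w θ), Real.exp m, ?_, fun θ => (hwa θ).rexp, fun θ => ?_,
    fun θ => Real.exp_pos _, fun θ => ?_, fun θ => ?_⟩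
  · rw [← Real.exp_log hμ]
    exact Real.exp_le_exp.2 hm
  · simp only [hwp θ]
  · rw [hstep]
    exact mul_le_mul_of_nonneg_right (hr2 _) (Real.exp_pos _).le
  · have h1 := hstep (θ - ω)
    rw [sub_add_cancel] at h1
    have h2 : r ((θ : UnitAddCircle) - a) = r ((θ - ω : ℝ) : UnitAddCircle) := by simp [a]
    have h3 := hr (θ : UnitAddCircle)
    rw [h2] at h3
    have h4 := hr0 ((θ - ω : ℝ) : UnitAddCircle)
    have h5 : (Real.exp m)⁻¹ * Real.exp (w (θ - ω)) =
        (r ((θ - ω : ℝ) : UnitAddCircle))⁻¹ * Real.exp (w θ) := by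
      have := Real.exp_pos m
      field_simp
      linarith
    rw [hstep, h5, h3]
    ring

/-- The golden mean rotation has linearly bounded small divisors. -/
lemma golden_small_divisors {ω : ℝ} (hω : ω = (Real.sqrt 5 - 1) / 2) (k : ℤ) (hk : k ≠ 0) :
    fourier k (ω : UnitAddCircle) ≠ 1 ∧
      ‖(fourier k (ω : UnitAddCircle) - 1)⁻¹‖ ≤ 3 * |(k : ℝ)| := by
  have h5 : Real.sqrt 5 ^ 2 = 5 := Real.sq_sqrt (by norm_num)
  have h50 : 0 ≤ Real.sqrt 5 := Real.sqrt_nonneg 5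
  have hk1 : (1 : ℝ) ≤ |(k : ℝ)| := by exact_mod_cast Int.one_le_abs hk
  set m := round ((k : ℝ) * ω)
  set y := (k : ℝ) * ω - m
  have hy : |y| ≤ 1 / 2 := abs_sub_round _
  have hprod : y * (y - k * Real.sqrt 5) = ((m ^ 2 + k * m - k ^ 2 : ℤ) : ℝ) := by
    simp only [y, hω]
    push_cast
    linear_combination (-(k : ℝ) ^ 2 / 4) * h5
  have hne : (m ^ 2 + k * m - k ^ 2 : ℤ) ≠ 0 := by
    intro h0
    have hirr : Irrational (Real.sqrt 5) := by
      simpa using Nat.Prime.irrational_sqrt (p := 5) (by norm_num)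
    have hkr : (k : ℝ) ≠ 0 := by exact_mod_cast hk
    have hsq : (2 * (m : ℝ) + k) ^ 2 = (k * Real.sqrt 5) ^ 2 := by
      have : ((m ^ 2 + k * m - k ^ 2 : ℤ) : ℝ) = 0 := by exact_mod_cast h0
      push_cast at this
      rw [mul_pow, h5]
      linear_combination 4 * this
    rcases sq_eq_sq_iff_eq_or_eq_neg.1 hsq with h | h
    · exact hirr ⟨(2 * m + k) / k, by push_cast; field_simp; linarith⟩
    · exact hirr ⟨-(2 * m + k) / k, by push_cast; field_simp; linarith⟩
  have hone : 1 ≤ |y| * |y - k * Real.sqrt 5| := by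
    rw [← abs_mul, hprod]
    exact_mod_cast Int.one_le_abs hne
  have hfar : |y - k * Real.sqrt 5| ≤ 3 * |(k : ℝ)| := by
    have h1 : Real.sqrt 5 ≤ 5 / 2 := by nlinarith
    calc |y - k * Real.sqrt 5| ≤ |y| + |k * Real.sqrt 5| := abs_sub _ _
      _ ≤ 1 / 2 + |(k : ℝ)| * (5 / 2) := by
          rw [abs_mul, abs_of_nonneg h50]
          gcongr
      _ ≤ _ := by linarith
  have hylow : 1 ≤ |y| * (3 * |(k : ℝ)|) := hone.trans (by gcongr)
  have hval : fourier k (ω : UnitAddCircle) =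
      Complex.exp (Complex.I * ((2 * Real.pi * y : ℝ) : ℂ)) := by
    rw [fourier_coe_real, ← Complex.exp_periodic.int_mul (-m)]
    congr 1
    simp only [y]
    push_cast
    ring
  have hnorm : 4 * |y| ≤ ‖fourier k (ω : UnitAddCircle) - 1‖ := by
    have hpi := Real.pi_pos
    rw [hval, Complex.norm_exp_I_mul_ofReal_sub_one]
    rw [show 2 * Real.pi * y / 2 = Real.pi * y by ring, norm_mul, Real.norm_ofNat,
      Real.norm_eq_abs]
    have h1 := Real.mul_abs_le_abs_sin (x := Real.pi * y) (by
      rw [abs_mul, abs_of_pos hpi]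
      nlinarith)
    rw [abs_mul, abs_of_pos hpi] at h1
    have h2 : 2 / Real.pi * (Real.pi * |y|) = 2 * |y| := by field_simp
    linarith
  have hy0 : 0 < |y| := by
    by_contra hcon
    nlinarith [abs_nonneg y]
  have hpos : 0 < ‖fourier k (ω : UnitAddCircle) - 1‖ := by linarith
  refine ⟨sub_ne_zero.1 (norm_pos_iff.1 hpos), ?_⟩
  rw [norm_inv, inv_le_iff_one_le_mul₀ hpos]
  nlinarith

lemma mul_sub_le_sin_sub {R c u v : ℝ} (hR : R ≤ Real.pi) (hc : c ≤ Real.cos R)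
    (hv : -R ≤ v) (hu : u ≤ R) (hvu : v ≤ u) : c * (u - v) ≤ Real.sin u - Real.sin v := by
  refine Convex.mul_sub_le_image_sub_of_le_deriv (convex_Icc (-R) R)
    Real.continuous_sin.continuousOn Real.differentiable_sin.differentiableOn (fun x hx => ?_)
    v ⟨hv, hvu.trans hu⟩ u ⟨hv.trans hvu, hu⟩ hvu
  rw [interior_Icc] at hx
  rw [Real.deriv_sin, ← Real.cos_abs x]
  exact hc.trans (Real.cos_le_cos_of_nonneg_of_le_pi (abs_nonneg x) hR
    (abs_le.2 ⟨hx.1.le, hx.2.le⟩))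

/-- A damped fixed-point step for the sine nonlinearity is a contraction where the cosine is
positive. -/
lemma abs_damped_sub_le {R c κ u v : ℝ} (hκ : 0 < κ) (hR : R ≤ Real.pi) (hc : c ≤ Real.cos R)
    (hu : |u| ≤ R) (hv : |v| ≤ R) :
    |(κ * u - κ * Real.sin u) - (κ * v - κ * Real.sin v)| ≤ κ * (1 - c) * |u - v| := by
  wlog h : v ≤ u generalizing u v
  · rw [abs_sub_comm, abs_sub_comm u]
    exact this hv hu (le_of_not_ge h)
  have h1 := mul_sub_le_sin_sub hR hc (abs_le.1 hv).1 (abs_le.1 hu).2 h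
  have h2 : Real.sin u - Real.sin v ≤ u - v := by
    have := Real.abs_sin_sub_sin_le u v
    rw [abs_of_nonneg (sub_nonneg.2 h)] at this
    exact (le_abs_self _).trans this
  rw [abs_of_nonneg (sub_nonneg.2 h), abs_of_nonneg] <;> nlinarith

/-- Existence of a solution of the sine difference equation near an approximate solution. -/
lemma exists_sine_equation {U₀ g : CircleFn} {a : UnitAddCircle} {κ c R ρ : ℝ} (hκ : 0 < κ)
    (hc0 : 0 < c) (hR : R ≤ Real.pi) (hc : c ≤ Real.cos R) (hρ : 0 ≤ ρ)
    (hU₀ : ∀ x, |U₀ x| + ρ ≤ R)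
    (hres : ∀ x, |U₀ (x + a) + U₀ (x - a) - 2 * U₀ x - κ * Real.sin (U₀ x) - g x| ≤ κ * c * ρ) :
    ∃ U : CircleFn, (∀ x, |U x - U₀ x| ≤ ρ) ∧
      ∀ x, U (x + a) + U (x - a) - 2 * U x - κ * Real.sin (U x) = g x := by
  have hc1 : c ≤ 1 := hc.trans (Real.cos_le_one R)
  set h : ℝ := (2 + κ)⁻¹ with hh
  have hpos : 0 < h := by positivity
  have hhκ : h * (2 + κ) = 1 := inv_mul_cancel₀ (by positivity)
  let Φ : CircleFn → CircleFn := fun f =>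
    f + h • (shift a f + shift (-a) f - (2 : ℝ) • f - κ • sinFn f - g)
  have hΦ : ∀ f x, Φ f x =
      f x + h * (f (x + a) + f (x - a) - 2 * f x - κ * Real.sin (f x) - g x) := fun f x => by
    simp [Φ, sub_eq_add_neg]
    ring
  have hk0 : 0 ≤ 1 - h * κ * c := by nlinarith [mul_pos hpos hκ]
  let k : NNReal := ⟨1 - h * κ * c, hk0⟩
  let S : Set CircleFn := Metric.closedBall U₀ ρ
  have hSx : ∀ f ∈ S, ∀ x, |f x| ≤ R := fun f hf x => by
    have h1 := (ContinuousMap.dist_apply_le_dist (f := f) (g := U₀) x).trans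
      (Metric.mem_closedBall.1 hf)
    rw [Real.dist_eq] at h1
    have h2 := abs_sub_abs_le_abs_sub (f x) (U₀ x)
    linarith [hU₀ x]
  have hlip : ∀ f ∈ S, ∀ f' ∈ S, dist (Φ f) (Φ f') ≤ k * dist f f' := by
    intro f hf f' hf'
    rw [ContinuousMap.dist_le (by positivity)]
    intro x
    have hd : ∀ y, |f y - f' y| ≤ dist f f' := fun y => by
      simpa [Real.dist_eq] using ContinuousMap.dist_apply_le_dist (f := f) (g := f') y
    have h1 := (abs_damped_sub_le hκ hR hc (hSx f hf x) (hSx f' hf' x)).trans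
      (mul_le_mul_of_nonneg_left (hd x) (by nlinarith))
    have h2 := hd (x + a)
    have h3 := hd (x - a)
    rw [Real.dist_eq, hΦ, hΦ]
    have h4 : f x + h * (f (x + a) + f (x - a) - 2 * f x - κ * Real.sin (f x) - g x) -
        (f' x + h * (f' (x + a) + f' (x - a) - 2 * f' x - κ * Real.sin (f' x) - g x)) =
        h * ((f (x + a) - f' (x + a)) + (f (x - a) - f' (x - a)) +
          ((κ * f x - κ * Real.sin (f x)) - (κ * f' x - κ * Real.sin (f' x)))) := by
      linear_combination (f' x - f x) * hhκ
    have h5 : (k : ℝ) * dist f f' = h * (dist f f' + dist f f' + κ * (1 - c) * dist f f') := by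
      change (1 - h * κ * c) * dist f f' = _
      linear_combination (-dist f f') * hhκ
    rw [h4, abs_mul, abs_of_pos hpos, h5]
    gcongr
    exact (abs_add_three _ _ _).trans (by gcongr)
  have hΦU₀ : dist (Φ U₀) U₀ ≤ h * (κ * c * ρ) := by
    rw [ContinuousMap.dist_le (by positivity)]
    intro x
    rw [Real.dist_eq, hΦ, add_sub_cancel_left, abs_mul, abs_of_pos hpos]
    gcongr
    exact hres x
  have hU₀S : U₀ ∈ S := Metric.mem_closedBall_self hρ
  have hmaps : Set.MapsTo Φ S S := fun f hf => by
    have h1 := hlip f hf U₀ hU₀S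
    have h2 := dist_triangle (Φ f) (Φ U₀) U₀
    have h3 : (k : ℝ) * dist f U₀ ≤ (1 - h * κ * c) * ρ :=
      mul_le_mul_of_nonneg_left (Metric.mem_closedBall.1 hf) hk0
    refine Metric.mem_closedBall.2 ?_
    linarith
  have hcontr : ContractingWith k (hmaps.restrict Φ S S) := by
    refine ⟨?_, LipschitzWith.of_dist_le_mul fun f f' => hlip f.1 f.2 f'.1 f'.2⟩
    rw [← NNReal.coe_lt_coe]
    change 1 - h * κ * c < 1
    linarith [mul_pos (mul_pos hpos hκ) hc0]
  obtain ⟨U, hUS, hU, -⟩ := hcontr.exists_fixedPoint' Metric.isClosed_closedBall.isComplete hmaps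
    hU₀S (edist_ne_top _ _)
  refine ⟨U, fun x => ?_, fun x => ?_⟩
  · simpa [Real.dist_eq] using (ContinuousMap.dist_apply_le_dist (f := U) (g := U₀) x).trans
      (Metric.mem_closedBall.1 hUS)
  · have h1 := congrArg (fun f : CircleFn => f x) hU
    simp only [hΦ] at h1
    have h2 : h * (U (x + a) + U (x - a) - 2 * U x - κ * Real.sin (U x) - g x) = 0 := by linarith
    have h3 := (mul_eq_zero.1 h2).resolve_left hpos.ne'
    linarith

lemma abs_cos_sin_sub_taylor_le {x : ℝ} (hx : |x| ≤ 1) :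
    |Real.cos x - (1 - x ^ 2 / 2 + x ^ 4 / 24 - x ^ 6 / 720)| ≤ |x| ^ 8 / 35840 ∧
    |Real.sin x - (x - x ^ 3 / 6 + x ^ 5 / 120 - x ^ 7 / 5040)| ≤ |x| ^ 8 / 35840 := by
  have hz : ‖(x * Complex.I : ℂ)‖ = |x| := by simp
  have h := Complex.exp_bound (x := x * Complex.I) (by rwa [hz]) (n := 8) (by norm_num)
  rw [hz] at h
  have hI : Complex.I ^ 2 = -1 := Complex.I_sq
  have key : Complex.exp (x * Complex.I) -
      ∑ m ∈ Finset.range 8, (x * Complex.I : ℂ) ^ m / m.factorial =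
      ((Real.cos x - (1 - x ^ 2 / 2 + x ^ 4 / 24 - x ^ 6 / 720) : ℝ) : ℂ) +
      ((Real.sin x - (x - x ^ 3 / 6 + x ^ 5 / 120 - x ^ 7 / 5040) : ℝ) : ℂ) * Complex.I := by
    have h3 : Complex.I ^ 3 = -Complex.I := by rw [pow_succ, hI]; ring
    have h4 : Complex.I ^ 4 = 1 := by rw [pow_succ, h3]; simp
    have h5 : Complex.I ^ 5 = Complex.I := by rw [pow_succ, h4]; ring
    have h6 : Complex.I ^ 6 = -1 := by rw [pow_succ, h5]; simp
    have h7 : Complex.I ^ 7 = -Complex.I := by rw [pow_succ, h6]; ring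
    rw [Complex.exp_mul_I]
    simp only [Finset.sum_range_succ, Finset.sum_range_zero, mul_pow, hI, h3, h4, h5, h6, h7,
      Nat.factorial]
    push_cast
    ring
  have hbound : |x| ^ 8 * (Nat.succ 8 * ((Nat.factorial 8 : ℕ) * (8 : ℕ) : ℝ)⁻¹) =
      |x| ^ 8 / 35840 := by
    norm_num [Nat.factorial]
    ring
  rw [key, hbound] at h
  have hre := (Complex.abs_re_le_norm _).trans h
  have him := (Complex.abs_im_le_norm _).trans h
  simp only [Complex.add_re, Complex.add_im, Complex.re_ofReal_mul, Complex.im_ofReal_mul,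
    Complex.I_re, Complex.I_im, Complex.ofReal_re, Complex.ofReal_im, mul_zero, mul_one,
    add_zero, zero_add] at hre him
  exact ⟨hre, him⟩

/-- `c` and `s` approximate the cosine and sine of `x` up to `e`. -/
def TrigApprox (x c s e : ℝ) : Prop := |Real.cos x - c| ≤ e ∧ |Real.sin x - s| ≤ e

lemma TrigApprox.weaken {x c s e c' s' e' : ℝ} (h : TrigApprox x c s e)
    (hc : |c - c'| ≤ e' - e) (hs : |s - s'| ≤ e' - e) : TrigApprox x c' s' e' :=
  ⟨by linarith [abs_sub_le (Real.cos x) c c', h.1], by linarith [abs_sub_le (Real.sin x) s s', h.2]⟩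

lemma TrigApprox.add {x y c s c' s' e e' : ℝ} (h : TrigApprox x c s e)
    (h' : TrigApprox y c' s' e') (h1 : |c'| ≤ 1) (h2 : |s'| ≤ 1) :
    TrigApprox (x + y) (c * c' - s * s') (s * c' + c * s') (2 * (e + e')) := by
  obtain ⟨hc, hs⟩ := h
  obtain ⟨hc', hs'⟩ := h'
  have hmul : ∀ {a a₀ b b₀ : ℝ}, |a - a₀| ≤ e → |b - b₀| ≤ e' → |a| ≤ 1 → |b₀| ≤ 1 →
      |a * b - a₀ * b₀| ≤ e + e' := fun {a a₀ b b₀} ha hb h1 h2 => by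
    have h3 : |a * (b - b₀)| ≤ e' := by
      rw [abs_mul]
      exact (mul_le_of_le_one_left (abs_nonneg _) h1).trans hb
    have h4 : |(a - a₀) * b₀| ≤ e := by
      rw [abs_mul]
      exact (mul_le_of_le_one_right (abs_nonneg _) h2).trans ha
    have h5 : a * b - a₀ * b₀ = (a - a₀) * b₀ + a * (b - b₀) := by ring
    rw [h5]
    exact (abs_add_le _ _).trans (add_le_add h4 h3)
  have p1 := abs_le.1 (hmul hc hc' (Real.abs_cos_le_one x) h1)
  have p2 := abs_le.1 (hmul hs hs' (Real.abs_sin_le_one x) h2)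
  have p3 := abs_le.1 (hmul hs hc' (Real.abs_sin_le_one x) h1)
  have p4 := abs_le.1 (hmul hc hs' (Real.abs_cos_le_one x) h2)
  rw [TrigApprox, Real.cos_add, Real.sin_add]
  constructor <;> rw [abs_le] <;> constructor <;>
    linarith [p1.1, p1.2, p2.1, p2.2, p3.1, p3.2, p4.1, p4.2]

lemma trigApprox_golden : TrigApprox (2 * Real.pi * ((Real.sqrt 5 - 1) / 2))
    (-0.737368878) (-0.675490294) 0.0000005 := by
  set h : ℝ := Real.pi * (Real.sqrt 5 - 2) / 2 with hh
  have s1 : (2.23606797 : ℝ) ≤ Real.sqrt 5 := Real.le_sqrt_of_sq_le (by norm_num)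
  have s2 : Real.sqrt 5 ≤ 2.23606798 := Real.sqrt_le_iff.2 ⟨by norm_num, by norm_num⟩
  have hclose : |h - 0.37081471| ≤ 0.00000003 := by
    have p1 := Real.pi_gt_d20
    have p2 := Real.pi_lt_d20
    rw [abs_le]
    constructor <;> nlinarith
  have taylor := abs_cos_sin_sub_taylor_le (x := 0.37081471) (by norm_num [abs_of_pos])
  rw [abs_of_pos (by norm_num : (0 : ℝ) < 0.37081471)] at taylor
  have hc := Real.abs_cos_sub_cos_le h 0.37081471
  have hs := Real.abs_sin_sub_sin_le h 0.37081471
  have hhalf : TrigApprox h 0.93203242 0.36237489 0.0000001 := by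
    have t1 := abs_le.1 taylor.1
    have t2 := abs_le.1 taylor.2
    have c1 := abs_le.1 (hc.trans hclose)
    have c2 := abs_le.1 (hs.trans hclose)
    constructor <;> rw [abs_le] <;> constructor <;> norm_num at t1 t2 c1 c2 ⊢ <;> linarith
  have hdouble := (hhalf.add hhalf (by norm_num [abs_of_pos]) (by norm_num [abs_of_pos])).weaken
    (c' := 0.737368878) (s' := 0.675490294) (e' := 0.0000005)
    (by rw [abs_le]; norm_num) (by rw [abs_le]; norm_num)
  have hα : 2 * Real.pi * ((Real.sqrt 5 - 1) / 2) = h + h + Real.pi := by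
    rw [hh]
    ring
  rw [TrigApprox, hα, Real.cos_add_pi, Real.sin_add_pi, ← abs_neg (_ - _),
    ← abs_neg (-Real.sin _ - _)]
  refine ⟨?_, ?_⟩
  · convert hdouble.1 using 2
    ring
  · convert hdouble.2 using 2
    ring

lemma trigApprox_golden_multiples {α : ℝ} (hα : α = 2 * Real.pi * ((Real.sqrt 5 - 1) / 2)) :
    TrigApprox (2 * α) 0.087425725 0.996171041 0.0000021 ∧
    TrigApprox (3 * α) 0.608438861 (-0.793600751) 0.000006 ∧
    TrigApprox (4 * α) (-0.984713485) 0.174181950 0.000009 ∧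
    TrigApprox (5 * α) 0.843755295 0.536728053 0.00002 ∧
    TrigApprox (6 * α) (-0.259604305) (-0.965715074) 0.00003 := by
  have h1 := trigApprox_golden
  rw [← hα] at h1
  have hstep : ∀ {x y z c s c' s' e e' c'' s'' e'' : ℝ}, TrigApprox x c s e →
      TrigApprox y c' s' e' → |c'| ≤ 1 → |s'| ≤ 1 → x + y = z →
      |(c * c' - s * s') - c''| ≤ e'' - 2 * (e + e') →
      |(s * c' + c * s') - s''| ≤ e'' - 2 * (e + e') → TrigApprox z c'' s'' e'' :=
    fun hx hy a1 a2 hz b1 b2 => hz ▸ (hx.add hy a1 a2).weaken b1 b2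
  have h2 : TrigApprox (2 * α) 0.087425725 0.996171041 0.0000021 := by
    refine hstep h1 h1 ?_ ?_ (by ring) ?_ ?_ <;> rw [abs_le] <;> norm_num
  have h3 : TrigApprox (3 * α) 0.608438861 (-0.793600751) 0.000006 := by
    refine hstep h2 h1 ?_ ?_ (by ring) ?_ ?_ <;> rw [abs_le] <;> norm_num
  have h4 : TrigApprox (4 * α) (-0.984713485) 0.174181950 0.000009 := by
    refine hstep h2 h2 ?_ ?_ (by ring) ?_ ?_ <;> rw [abs_le] <;> norm_num
  refine ⟨h2, h3, h4, ?_, ?_⟩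
  · refine hstep h4 h1 ?_ ?_ (by ring) ?_ ?_ <;> rw [abs_le] <;> norm_num
  · refine hstep h3 h3 ?_ ?_ (by ring) ?_ ?_ <;> rw [abs_le] <;> norm_num

/-- A trigonometric polynomial approximating the invariant torus, in the angle `x = 2πθ`. -/
noncomputable def approxTorus (x : ℝ) : ℝ :=
  0.66804 * Real.sin x - 0.008095 * Real.sin (3 * x) + 0.0003274 * Real.sin (5 * x)

lemma abs_approxTorus_le (x : ℝ) : |approxTorus x| ≤ 0.67647 := by
  rw [approxTorus, abs_le]
  constructor <;>
  linarith [Real.sin_le_one x, Real.neg_one_le_sin x, Real.sin_le_one (3 * x),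
    Real.neg_one_le_sin (3 * x), Real.sin_le_one (5 * x), Real.neg_one_le_sin (5 * x)]

lemma sin_odd_multiples (x : ℝ) :
    Real.sin (5 * x) = 16 * Real.sin x ^ 5 - 20 * Real.sin x ^ 3 + 5 * Real.sin x ∧
    Real.sin (7 * x) = 7 * Real.sin x - 56 * Real.sin x ^ 3 + 112 * Real.sin x ^ 5
      - 64 * Real.sin x ^ 7 ∧
    Real.sin (9 * x) = 9 * Real.sin x - 120 * Real.sin x ^ 3 + 432 * Real.sin x ^ 5
      - 576 * Real.sin x ^ 7 + 256 * Real.sin x ^ 9 ∧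
    Real.sin (11 * x) = 11 * Real.sin x - 220 * Real.sin x ^ 3 + 1232 * Real.sin x ^ 5
      - 2816 * Real.sin x ^ 7 + 2816 * Real.sin x ^ 9 - 1024 * Real.sin x ^ 11 := by
  have hrec : ∀ y, Real.sin (y + 2 * x) =
      2 * Real.sin y * (1 - 2 * Real.sin x ^ 2) - Real.sin (y - 2 * x) := fun y => by
    rw [Real.sin_add, Real.sin_sub, Real.cos_two_mul, Real.cos_sq']
    ring
  have h3 := Real.sin_three_mul x
  have h5 := hrec (3 * x)
  rw [show 3 * x + 2 * x = 5 * x by ring, show 3 * x - 2 * x = x by ring, h3] at h5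
  have h7 := hrec (5 * x)
  rw [show 5 * x + 2 * x = 7 * x by ring, show 5 * x - 2 * x = 3 * x by ring, h5, h3] at h7
  have h9 := hrec (7 * x)
  rw [show 7 * x + 2 * x = 9 * x by ring, show 7 * x - 2 * x = 5 * x by ring, h7, h5] at h9
  have h11 := hrec (9 * x)
  rw [show 9 * x + 2 * x = 11 * x by ring, show 9 * x - 2 * x = 7 * x by ring, h9, h7] at h11
  exact ⟨by rw [h5]; ring, by rw [h7]; ring, by rw [h9]; ring, by rw [h11]; ring⟩

lemma approxTorus_eq (x : ℝ) : approxTorus x =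
    0.645392 * Real.sin x + 0.025832 * Real.sin x ^ 3 + 0.0052384 * Real.sin x ^ 5 := by
  rw [approxTorus, Real.sin_three_mul, (sin_odd_multiples x).1]
  ring

lemma abs_sin_approxTorus_sub_le (x : ℝ) :
    |Real.sin (approxTorus x) - (approxTorus x - approxTorus x ^ 3 / 6 + approxTorus x ^ 5 / 120)|
      ≤ 0.000015 := by
  have hU := abs_approxTorus_le x
  have h1 := abs_le.1 (abs_cos_sin_sub_taylor_le (hU.trans (by norm_num))).2
  have h8 : |approxTorus x| ^ 8 ≤ 0.67647 ^ 8 := by gcongr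
  have h7 : |approxTorus x ^ 7| ≤ 0.67647 ^ 7 := by rw [abs_pow]; gcongr
  have h7' := abs_le.1 h7
  norm_num at h8 h7'
  rw [abs_le]
  constructor <;> linarith [h1.1, h1.2, h7'.1, h7'.2]

lemma abs_residual_polynomial_le (x : ℝ) :
    |0.66804 * (2 * (-0.737368878) - 2) * Real.sin x
      - 0.008095 * (2 * 0.608438861 - 2) * Real.sin (3 * x)
      + 0.0003274 * (2 * 0.843755295 - 2) * Real.sin (5 * x) + 3.1415926 * Real.sin x
      - 1.3 * (approxTorus x - approxTorus x ^ 3 / 6 + approxTorus x ^ 5 / 120)| ≤ 0.000036 := by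
  obtain ⟨h5, h7, h9, h11⟩ := sin_odd_multiples x
  have h3 := Real.sin_three_mul x
  rw [approxTorus_eq]
  have b1 := abs_le.1 (Real.abs_sin_le_one x)
  have b3 := abs_le.1 (Real.abs_sin_le_one (3 * x))
  have b5 := abs_le.1 (Real.abs_sin_le_one (5 * x))
  have b7 := abs_le.1 (Real.abs_sin_le_one (7 * x))
  have b9 := abs_le.1 (Real.abs_sin_le_one (9 * x))
  have b11 := abs_le.1 (Real.abs_sin_le_one (11 * x))
  rw [h3] at b3 ⊢
  rw [h5] at b5 ⊢
  rw [h7] at b7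
  rw [h9] at b9
  rw [h11] at b11
  have hs := Real.abs_sin_le_one x
  generalize Real.sin x = s at *
  have hp : ∀ n : ℕ, -1 ≤ s ^ n ∧ s ^ n ≤ 1 := fun n => by
    rw [← abs_le, abs_pow]
    exact pow_le_one₀ (abs_nonneg _) hs
  have p13 := hp 13
  have p15 := hp 15
  have p17 := hp 17
  have p19 := hp 19
  have p21 := hp 21
  have p23 := hp 23
  have p25 := hp 25
  clear hp hs h3 h5 h7 h9 h11
  rw [abs_le]
  constructor <;> linarith [b1.1, b1.2, b3.1, b3.2, b5.1, b5.2, b7.1, b7.2, b9.1, b9.2,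
    b11.1, b11.2, p13.1, p13.2, p15.1, p15.2, p17.1, p17.2, p19.1, p19.2, p21.1, p21.2,
    p23.1, p23.2, p25.1, p25.2]

/-- The approximate torus solves the sine equation up to a small residual. -/
lemma abs_approxTorus_residual_le {α : ℝ} (hα : α = 2 * Real.pi * ((Real.sqrt 5 - 1) / 2))
    (x : ℝ) :
    |approxTorus (x + α) + approxTorus (x - α) - 2 * approxTorus x
      - 1.3 * Real.sin (approxTorus x) - (-Real.pi * Real.sin x)| ≤ 0.000059 := by
  have h1 := trigApprox_golden.1
  rw [← hα] at h1
  obtain ⟨-, ⟨h3, -⟩, -, ⟨h5, -⟩, -⟩ := trigApprox_golden_multiples hα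
  have hsum : approxTorus (x + α) + approxTorus (x - α) =
      0.66804 * (2 * Real.cos α) * Real.sin x - 0.008095 * (2 * Real.cos (3 * α)) * Real.sin (3 * x)
      + 0.0003274 * (2 * Real.cos (5 * α)) * Real.sin (5 * x) := by
    simp only [approxTorus, mul_add, mul_sub, Real.sin_add, Real.sin_sub]
    ring
  have hmul : ∀ {a b e : ℝ}, |a| ≤ e → |b| ≤ 1 → -e ≤ a * b ∧ a * b ≤ e := fun {a b e} ha hb => by
    rw [← abs_le, abs_mul]
    exact (mul_le_of_le_one_right (abs_nonneg _) hb).trans ha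
  have e1 := hmul h1 (Real.abs_sin_le_one x)
  have e3 := hmul h3 (Real.abs_sin_le_one (3 * x))
  have e5 := hmul h5 (Real.abs_sin_le_one (5 * x))
  have hpi : |Real.pi - 3.1415926| ≤ 0.0000001 := by
    rw [abs_le]
    constructor <;> linarith [Real.pi_gt_d20, Real.pi_lt_d20]
  have epi := hmul hpi (Real.abs_sin_le_one x)
  have hpoly := abs_le.1 (abs_residual_polynomial_le x)
  have hsin := abs_le.1 (abs_sin_approxTorus_sub_le x)
  have hU : 2 * approxTorus x = 0.66804 * 2 * Real.sin x - 0.008095 * 2 * Real.sin (3 * x)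
      + 0.0003274 * 2 * Real.sin (5 * x) := by
    rw [approxTorus]
    ring
  rw [hsum, hU, abs_le]
  constructor <;> linarith [e1.1, e1.2, e3.1, e3.2, e5.1, e5.2, epi.1, epi.2, hpoly.1, hpoly.2,
    hsin.1, hsin.2]

lemma cos_even_multiples (x : ℝ) :
    Real.cos (2 * x) = 1 - 2 * Real.sin x ^ 2 ∧
    Real.cos (4 * x) = 1 - 8 * Real.sin x ^ 2 + 8 * Real.sin x ^ 4 ∧
    Real.cos (6 * x) = 1 - 18 * Real.sin x ^ 2 + 48 * Real.sin x ^ 4 - 32 * Real.sin x ^ 6 ∧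
    Real.cos (8 * x) = 1 - 32 * Real.sin x ^ 2 + 160 * Real.sin x ^ 4 - 256 * Real.sin x ^ 6
      + 128 * Real.sin x ^ 8 := by
  have h2 : Real.cos (2 * x) = 1 - 2 * Real.sin x ^ 2 := by
    rw [Real.cos_two_mul, Real.cos_sq']
    ring
  refine ⟨h2, ?_, ?_, ?_⟩
  · rw [show 4 * x = 2 * (2 * x) by ring, Real.cos_two_mul, h2]
    ring
  · rw [show 6 * x = 3 * (2 * x) by ring, Real.cos_three_mul, h2]
    ring
  · rw [show 8 * x = 2 * (2 * (2 * x)) by ring, Real.cos_two_mul, Real.cos_two_mul, h2]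
    ring

/-- A lower bound for the trace of the linearized dynamics near the approximate torus. -/
noncomputable def traceLower (x : ℝ) : ℝ :=
  3.1589 + 0.143041 * Real.cos (2 * x) - 0.002137 * Real.cos (4 * x)
    + 0.000095 * Real.cos (6 * x)

lemma traceLower_le {x U : ℝ} (hU : |U - approxTorus x| ≤ 0.00006) :
    traceLower x ≤ 2 + 1.3 * Real.cos U := by
  have hA := abs_approxTorus_le x
  have h1 := (abs_le.1 (abs_cos_sin_sub_taylor_le (hA.trans (by norm_num))).1).1
  have h8 : |approxTorus x| ^ 8 ≤ 0.67647 ^ 8 := by gcongr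
  norm_num at h8
  have hcos := (abs_le.1 ((Real.abs_cos_sub_cos_le U (approxTorus x)).trans hU)).1
  suffices h : traceLower x ≤ 2 + 1.3 * (1 - approxTorus x ^ 2 / 2 + approxTorus x ^ 4 / 24
      - approxTorus x ^ 6 / 720) - 0.000082 by linarith
  obtain ⟨h2, h4, h6, h8⟩ := cos_even_multiples x
  rw [traceLower, approxTorus_eq]
  have b2 := abs_le.1 (Real.abs_cos_le_one (2 * x))
  have b4 := abs_le.1 (Real.abs_cos_le_one (4 * x))
  have b6 := abs_le.1 (Real.abs_cos_le_one (6 * x))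
  have b8 := abs_le.1 (Real.abs_cos_le_one (8 * x))
  rw [h2] at b2 ⊢
  rw [h4] at b4 ⊢
  rw [h6] at b6 ⊢
  rw [h8] at b8
  have hs := Real.abs_sin_le_one x
  generalize Real.sin x = s at *
  have hp : ∀ n : ℕ, 0 ≤ s ^ (2 * n) ∧ s ^ (2 * n) ≤ 1 := fun n => by
    rw [pow_mul]
    exact ⟨by positivity, pow_le_one₀ (sq_nonneg s) (by nlinarith [abs_le.1 hs])⟩
  have p10 := hp 5
  have p12 := hp 6
  have p14 := hp 7
  have p16 := hp 8
  have p18 := hp 9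
  have p20 := hp 10
  have p22 := hp 11
  have p24 := hp 12
  have p26 := hp 13
  have p28 := hp 14
  have p30 := hp 15
  norm_num at p10 p12 p14 p16 p18 p20 p22 p24 p26 p28 p30
  linarith [b2.1, b2.2, b4.1, b4.2, b6.1, b6.2, b8.1, b8.2, p10.1, p10.2, p12.1, p12.2,
    p14.1, p14.2, p16.1, p16.2, p18.1, p18.2, p20.1, p20.2, p22.1, p22.2, p24.1, p24.2,
    p26.1, p26.2, p28.1, p28.2, p30.1, p30.2]

/-- A positive trigonometric subsolution of the linearized equation. -/
noncomputable def subsolution (x : ℝ) : ℝ :=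
  1 - 0.028994 * Real.cos (2 * x) + 0.024468 * Real.sin (2 * x)
    + 0.000651 * Real.cos (4 * x) - 0.000323 * Real.sin (4 * x)
    - 0.000037 * Real.cos (6 * x) - 0.00001 * Real.sin (6 * x)

lemma abs_subsolution_sub_one_le (x : ℝ) : |subsolution x - 1| ≤ 0.055 := by
  rw [subsolution, abs_le]
  constructor <;>
  linarith [Real.sin_le_one (2 * x), Real.neg_one_le_sin (2 * x), Real.sin_le_one (4 * x),
    Real.neg_one_le_sin (4 * x), Real.sin_le_one (6 * x), Real.neg_one_le_sin (6 * x),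
    Real.cos_le_one (2 * x), Real.neg_one_le_cos (2 * x), Real.cos_le_one (4 * x),
    Real.neg_one_le_cos (4 * x), Real.cos_le_one (6 * x), Real.neg_one_le_cos (6 * x)]

lemma subsolution_pos (x : ℝ) : 0 < subsolution x := by
  linarith [(abs_le.1 (abs_subsolution_sub_one_le x)).1]

lemma two_mul_subsolution_le (x y : ℝ) : 2 * subsolution x ≤ 2500 / 893 * subsolution y := by
  linarith [(abs_le.1 (abs_subsolution_sub_one_le x)).2,
    (abs_le.1 (abs_subsolution_sub_one_le y)).1]

/-- Fourier expansion of the trace bound times the subsolution, up to rounding. -/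
lemma fourier_le_traceLower_mul_subsolution (x : ℝ) :
    3.156826 + 0.051529 * Real.cos (2 * x) + 0.077295 * Real.sin (2 * x)
      - 0.002158 * Real.cos (4 * x) + 0.000728 * Real.sin (4 * x)
      + 0.000056 * Real.cos (6 * x) - 0.000081 * Real.sin (6 * x)
      - 0.000012 ≤ traceLower x * subsolution x := by
  have hcc : ∀ a b : ℝ, Real.cos a * Real.cos b = (Real.cos (a + b) + Real.cos (a - b)) / 2 :=
    fun a b => by rw [Real.cos_add, Real.cos_sub]; ring
  have hcs : ∀ a b : ℝ, Real.cos a * Real.sin b = (Real.sin (a + b) - Real.sin (a - b)) / 2 :=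
    fun a b => by rw [Real.sin_add, Real.sin_sub]; ring
  have c22 := hcc (2 * x) (2 * x)
  have c24 := hcc (4 * x) (2 * x)
  have c26 := hcc (6 * x) (2 * x)
  have c44 := hcc (4 * x) (4 * x)
  have c46 := hcc (6 * x) (4 * x)
  have c66 := hcc (6 * x) (6 * x)
  have s22 := hcs (2 * x) (2 * x)
  have s24 := hcs (2 * x) (4 * x)
  have s26 := hcs (2 * x) (6 * x)
  have s42 := hcs (4 * x) (2 * x)
  have s44 := hcs (4 * x) (4 * x)
  have s46 := hcs (4 * x) (6 * x)
  have s62 := hcs (6 * x) (2 * x)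
  have s64 := hcs (6 * x) (4 * x)
  have s66 := hcs (6 * x) (6 * x)
  have n24 : 2 * x - 4 * x = -(2 * x) := by ring
  have n26 : 2 * x - 6 * x = -(4 * x) := by ring
  have n46 : 4 * x - 6 * x = -(2 * x) := by ring
  simp only [← add_mul, ← sub_mul, sub_self, n24, n26, n46, Real.sin_neg, Real.cos_zero,
    Real.sin_zero] at c22 c24 c26 c44 c46 c66 s22 s24 s26 s42 s44 s46 s62 s64 s66
  norm_num at c22 c24 c26 c44 c46 c66 s22 s24 s26 s42 s44 s46 s62 s64 s66
  have hcb := fun y => abs_le.1 (Real.abs_cos_le_one y)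
  have hsb := fun y => abs_le.1 (Real.abs_sin_le_one y)
  rw [traceLower, subsolution]
  linarith [(hcb (2 * x)).1, (hcb (2 * x)).2, (hcb (4 * x)).1, (hcb (4 * x)).2, (hcb (6 * x)).1, (hcb (6 * x)).2,
    (hcb (8 * x)).1, (hcb (8 * x)).2, (hcb (10 * x)).1, (hcb (10 * x)).2, (hcb (12 * x)).1, (hcb (12 * x)).2,
    (hsb (2 * x)).1, (hsb (2 * x)).2, (hsb (4 * x)).1, (hsb (4 * x)).2, (hsb (6 * x)).1, (hsb (6 * x)).2,
    (hsb (8 * x)).1, (hsb (8 * x)).2, (hsb (10 * x)).1, (hsb (10 * x)).2, (hsb (12 * x)).1, (hsb (12 * x)).2]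

lemma subsolution_le {α : ℝ} (hα : α = 2 * Real.pi * ((Real.sqrt 5 - 1) / 2)) (x : ℝ) :
    2500 / 893 * subsolution (x + α) + (2500 / 893)⁻¹ * subsolution (x - α) ≤
      traceLower x * subsolution x := by
  obtain ⟨⟨h2, h2'⟩, -, ⟨h4, h4'⟩, -, h6, h6'⟩ := trigApprox_golden_multiples hα
  refine le_trans ?_ (fourier_le_traceLower_mul_subsolution x)
  have hmul : ∀ {a b e : ℝ}, |a| ≤ e → |b| ≤ 1 → -e ≤ a * b ∧ a * b ≤ e := fun {a b e} ha hb => by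
    rw [← abs_le, abs_mul]
    exact (mul_le_of_le_one_right (abs_nonneg _) hb).trans ha
  have u1 := hmul h2 (Real.abs_cos_le_one (2 * x))
  have u2 := hmul h2 (Real.abs_sin_le_one (2 * x))
  have u3 := hmul h2' (Real.abs_cos_le_one (2 * x))
  have u4 := hmul h2' (Real.abs_sin_le_one (2 * x))
  have v1 := hmul h4 (Real.abs_cos_le_one (4 * x))
  have v2 := hmul h4 (Real.abs_sin_le_one (4 * x))
  have v3 := hmul h4' (Real.abs_cos_le_one (4 * x))
  have v4 := hmul h4' (Real.abs_sin_le_one (4 * x))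
  have w1 := hmul h6 (Real.abs_cos_le_one (6 * x))
  have w2 := hmul h6 (Real.abs_sin_le_one (6 * x))
  have w3 := hmul h6' (Real.abs_cos_le_one (6 * x))
  have w4 := hmul h6' (Real.abs_sin_le_one (6 * x))
  have hcb := fun y => abs_le.1 (Real.abs_cos_le_one y)
  have hsb := fun y => abs_le.1 (Real.abs_sin_le_one y)
  simp only [subsolution, mul_add, mul_sub, Real.cos_add, Real.sin_add, Real.cos_sub,
    Real.sin_sub]
  linarith [u1.1, u1.2, u2.1, u2.2, u3.1, u3.2, u4.1, u4.2, v1.1, v1.2, v2.1, v2.2, v3.1, v3.2,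
    v4.1, v4.2, w1.1, w1.2, w2.1, w2.2, w3.1, w3.2, w4.1, w4.2,
    (hcb (2 * x)).1, (hcb (2 * x)).2, (hcb (4 * x)).1, (hcb (4 * x)).2, (hcb (6 * x)).1, (hcb (6 * x)).2,
    (hsb (2 * x)).1, (hsb (2 * x)).2, (hsb (4 * x)).1, (hsb (4 * x)).2, (hsb (6 * x)).1, (hsb (6 * x)).2]

/-- The circle function `t ↦ f (2πt)` of a continuous `2π`-periodic function `f`. -/
noncomputable def ofAngle (f : ℝ → ℝ) (hf : Continuous f) (hp : Function.Periodic f (2 * Real.pi)) :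
    CircleFn where
  toFun := Function.Periodic.lift (f := fun t : ℝ => f (2 * Real.pi * t)) (c := 1) fun t => by
    simp only [mul_add, mul_one]
    exact hp _
  continuous_toFun := continuous_coinduced_dom.2 (by
    change Continuous fun t : ℝ => f (2 * Real.pi * t)
    fun_prop)

@[simp] lemma ofAngle_coe {f : ℝ → ℝ} (hf : Continuous f)
    (hp : Function.Periodic f (2 * Real.pi)) (t : ℝ) :
    ofAngle f hf hp (t : UnitAddCircle) = f (2 * Real.pi * t) := rfl

lemma forall_coe {p : UnitAddCircle → Prop} (h : ∀ t : ℝ, p (t : UnitAddCircle)) (x) : p x :=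
  QuotientAddGroup.induction_on x h

lemma sin_mul_periodic (n : ℤ) : Function.Periodic (fun x : ℝ => Real.sin (n * x))
    (2 * Real.pi) := fun x => by
  simp only [mul_add]
  exact Real.sin_add_int_mul_two_pi _ n

lemma cos_mul_periodic (n : ℤ) : Function.Periodic (fun x : ℝ => Real.cos (n * x))
    (2 * Real.pi) := fun x => by
  simp only [mul_add]
  exact Real.cos_add_int_mul_two_pi _ n

/-- The forcing term of the sine equation. -/
noncomputable def forcing : CircleFn :=
  ofAngle (fun x => -Real.pi * Real.sin x) (by fun_prop) fun x => by simp

lemma forcing_coe (t : ℝ) : forcing (t : UnitAddCircle) = -Real.pi * Real.sin (2 * Real.pi * t) :=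
  rfl

lemma analyticOrbit_forcing : AnalyticOrbit forcing := by
  obtain ⟨C, hC⟩ : ∃ C : CircleFn, ∀ t : ℝ,
      C (t : UnitAddCircle) = -Real.pi * Real.cos (2 * Real.pi * t) :=
    ⟨ofAngle (fun x => -Real.pi * Real.cos x) (by fun_prop) fun x => by simp, fun t => rfl⟩
  have key : ∀ t : ℝ, shift (t : UnitAddCircle) forcing =
      Real.cos (2 * Real.pi * t) • forcing + Real.sin (2 * Real.pi * t) • C := fun t => by
    ext x
    induction x using QuotientAddGroup.induction_on with | H s => ?_
    change forcing ((s + t : ℝ) : UnitAddCircle) = Real.cos (2 * Real.pi * t) *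
      forcing (s : UnitAddCircle) + Real.sin (2 * Real.pi * t) * C (s : UnitAddCircle)
    rw [forcing_coe, forcing_coe, hC, mul_add, Real.sin_add]
    ring
  simp only [AnalyticOrbit, key]
  have hlin : AnalyticAt ℝ (fun t : ℝ => 2 * Real.pi * t) 0 := by fun_prop
  have hcos : AnalyticAt ℝ (fun t : ℝ => Real.cos (2 * Real.pi * t)) 0 :=
    Real.analyticAt_cos.comp hlin
  have hsin : AnalyticAt ℝ (fun t : ℝ => Real.sin (2 * Real.pi * t)) 0 :=
    Real.analyticAt_sin.comp hlin
  exact (hcos.smul analyticAt_const).add (hsin.smul analyticAt_const)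

/-- The approximate torus as a circle function. -/
noncomputable def approxTorusFn : CircleFn :=
  ofAngle approxTorus (by unfold approxTorus; fun_prop) fun x => by
    have h3 := sin_mul_periodic 3 x
    have h5 := sin_mul_periodic 5 x
    push_cast at h3 h5
    simp only [approxTorus, Real.sin_add_two_pi, h3, h5]

lemma approxTorusFn_coe (t : ℝ) :
    approxTorusFn (t : UnitAddCircle) = approxTorus (2 * Real.pi * t) := rfl

lemma traceLower_neg (x : ℝ) : traceLower (-x) = traceLower x := by
  simp [traceLower]

lemma continuous_subsolution : Continuous subsolution := by
  unfold subsolution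
  fun_prop

lemma subsolution_periodic : Function.Periodic subsolution (2 * Real.pi) := fun x => by
  have h2 := sin_mul_periodic 2 x
  have h4 := sin_mul_periodic 4 x
  have h6 := sin_mul_periodic 6 x
  have c2 := cos_mul_periodic 2 x
  have c4 := cos_mul_periodic 4 x
  have c6 := cos_mul_periodic 6 x
  push_cast at h2 h4 h6 c2 c4 c6
  simp only [subsolution, h2, h4, h6, c2, c4, c6]

/-- The invariant torus, as an analytic solution of the sine equation near the approximate one. -/
lemma exists_torus {ω : ℝ} (hω : ω = (Real.sqrt 5 - 1) / 2) :
    ∃ U : CircleFn, AnalyticOrbit U ∧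
      (∀ t : ℝ, |U (t : UnitAddCircle) - approxTorus (2 * Real.pi * t)| ≤ 0.00006) ∧
      ∀ t : ℝ, U ((t + ω : ℝ) : UnitAddCircle) + U ((t - ω : ℝ) : UnitAddCircle)
        - 2 * U (t : UnitAddCircle) - 1.3 * Real.sin (U (t : UnitAddCircle)) =
          -Real.pi * Real.sin (2 * Real.pi * t) := by
  have hcosR : (0.779 : ℝ) ≤ Real.cos 0.677 := by
    have h := (abs_le.1 (abs_cos_sin_sub_taylor_le (x := 0.677) (by norm_num [abs_of_pos])).1).1
    rw [abs_of_pos (by norm_num)] at h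
    norm_num at h ⊢
    linarith
  have hR : (0.677 : ℝ) ≤ Real.pi := by linarith [Real.pi_gt_three]
  have hα : 2 * Real.pi * ω = 2 * Real.pi * ((Real.sqrt 5 - 1) / 2) := by rw [hω]
  obtain ⟨U, hU, heq⟩ := exists_sine_equation (U₀ := approxTorusFn) (g := forcing)
    (a := (ω : UnitAddCircle)) (κ := 1.3) (c := 0.779) (R := 0.677) (ρ := 0.00006) (by norm_num)
    (by norm_num) hR hcosR (by norm_num)
    (forall_coe fun t => by
      rw [approxTorusFn_coe]
      linarith [abs_approxTorus_le (2 * Real.pi * t)])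
    (forall_coe fun t => by
      have h := abs_approxTorus_residual_le hα (2 * Real.pi * t)
      rw [← mul_add, ← mul_sub] at h
      rw [← AddCircle.coe_add, ← AddCircle.coe_sub]
      exact h.trans (by norm_num))
  have hU' : ∀ t : ℝ, |U (t : UnitAddCircle) - approxTorus (2 * Real.pi * t)| ≤ 0.00006 :=
    fun t => hU t
  refine ⟨U, AnalyticOrbit.of_sine_equation (κ := 1.3) (δ := 1) one_pos
    (forall_coe fun t => ?_) analyticOrbit_forcing heq, hU', fun t => heq t⟩
  have h1 : |U (t : UnitAddCircle)| ≤ 0.677 := by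
    have h2 := abs_sub_abs_le_abs_sub (U (t : UnitAddCircle)) (approxTorus (2 * Real.pi * t))
    linarith [hU' t, abs_approxTorus_le (2 * Real.pi * t)]
  have h3 := Real.cos_le_cos_of_nonneg_of_le_pi (abs_nonneg _) hR h1
  rw [Real.cos_abs] at h3
  linarith

/-- A positive Floquet solution of the linearized equation along the invariant torus, in either
time direction. -/
lemma exists_floquet_solution {ω : ℝ} (hω : ω = (Real.sqrt 5 - 1) / 2) {U : CircleFn}
    (hU : AnalyticOrbit U)
    (hU₀ : ∀ t : ℝ, |U (t : UnitAddCircle) - approxTorus (2 * Real.pi * t)| ≤ 0.00006) (ω' : ℝ)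
    (hω' : ω' = ω ∨ ω' = -ω) :
    ∃ (ψ : ℝ → ℝ) (lam : ℝ), 2500 / 893 ≤ lam ∧ (∀ θ, AnalyticAt ℝ ψ θ) ∧
      Function.Periodic ψ 1 ∧ (∀ θ, 0 < ψ θ) ∧ (∀ θ, 2 * ψ θ ≤ lam * ψ (θ + ω')) ∧
      ∀ θ : ℝ, lam * ψ (θ + ω') + lam⁻¹ * ψ (θ - ω') =
        (2 + 1.3 * Real.cos (U (θ : UnitAddCircle))) * ψ θ := by
  let G : CircleFn → CircleFn := fun f => ContinuousMap.const _ 2 + (1.3 : ℝ) • cosFn f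
  have hcos : AnalyticAt ℝ (fun f : CircleFn => (1.3 : ℝ) • cosFn f) U :=
    (((1.3 : ℝ) • ContinuousLinearMap.id ℝ CircleFn).analyticAt _).comp (analyticAt_cosFn U)
  have hd : AnalyticOrbit (G U) := hU.map (analyticAt_const.add hcos) fun a g => by
      ext x
      simp [G]
  have hGU : ∀ x, G U x = 2 + 1.3 * Real.cos (U x) := fun x => rfl
  have hα : 2 * Real.pi * ω = 2 * Real.pi * ((Real.sqrt 5 - 1) / 2) := by rw [hω]
  obtain ⟨σ, hσ, rfl⟩ : ∃ σ : ℝ, (σ = 1 ∨ σ = -1) ∧ ω' = σ * ω := by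
    rcases hω' with rfl | rfl
    · exact ⟨1, by simp⟩
    · exact ⟨-1, by simp⟩
  have hper : Function.Periodic (fun x => subsolution (σ * x)) (2 * Real.pi) := fun x => by
    rcases hσ with rfl | rfl
    · simpa using subsolution_periodic x
    · have h := subsolution_periodic.sub_eq (-x)
      rw [← neg_add'] at h
      simpa only [neg_one_mul] using h
  have hσσ : σ * σ = 1 := by rcases hσ with rfl | rfl <;> norm_num
  have hdiv : ∀ k : ℤ, k ≠ 0 → fourier k ((σ * ω : ℝ) : UnitAddCircle) ≠ 1 ∧
      ‖(fourier k ((σ * ω : ℝ) : UnitAddCircle) - 1)⁻¹‖ ≤ 3 * |(k : ℝ)| := fun k hk => by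
    rcases hσ with rfl | rfl
    · simpa using golden_small_divisors hω k hk
    · have h := golden_small_divisors hω (-k) (neg_ne_zero.2 hk)
      have h2 : fourier k ((-1 * ω : ℝ) : UnitAddCircle) = fourier (-k) (ω : UnitAddCircle) := by
        simp [fourier_apply]
      rw [h2]
      simpa using h
  obtain ⟨ψ, lam, h⟩ := exists_floquet (d := G U)
    (φ := ofAngle (fun x => subsolution (σ * x))
      (continuous_subsolution.comp (continuous_const.mul continuous_id)) hper) hd
    (ω := σ * ω) (μ := 2500 / 893) (M := 3) hdiv (by norm_num)
    (forall_coe fun t => subsolution_pos _) (forall_coe fun t => two_mul_subsolution_le _ _)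
    (forall_coe fun t => by
      have hs := subsolution_le hα (σ * (2 * Real.pi * t))
      have htr : traceLower (σ * (2 * Real.pi * t)) = traceLower (2 * Real.pi * t) := by
        rcases hσ with rfl | rfl
        · rw [one_mul]
        · rw [neg_one_mul, traceLower_neg]
      rw [← AddCircle.coe_add, ← AddCircle.coe_sub, ofAngle_coe, ofAngle_coe, ofAngle_coe, hGU]
      have e1 : σ * (2 * Real.pi * (t + σ * ω)) = σ * (2 * Real.pi * t) + 2 * Real.pi * ω := by
        linear_combination (2 * Real.pi * ω) * hσσ
      have e2 : σ * (2 * Real.pi * (t - σ * ω)) = σ * (2 * Real.pi * t) - 2 * Real.pi * ω := by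
        linear_combination (-(2 * Real.pi * ω)) * hσσ
      rw [e1, e2]
      rw [htr] at hs
      exact hs.trans (mul_le_mul_of_nonneg_right (traceLower_le (hU₀ t)) (subsolution_pos _).le))
  exact ⟨ψ, lam, h⟩

end CircleFn

/-- For ω the golden mean, κ = 1.3, ε = 0.5, the perturbed standard map has
a real-analytic, 1-periodic fiberwise hyperbolic invariant torus with constant diagonal
reduced linearized dynamics, with `|λ_s| ≤ 0.3572` and `|λ_u| ≥ 2.799`. -/
theorem hyperbolic_torus_eps (ω : ℝ) (hω : ω = (Real.sqrt 5 - 1) / 2) :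
    ∃ (K : ℝ → ℝ × ℝ) (P : ℝ → Matrix (Fin 2) (Fin 2) ℝ) (lams lamu : ℝ),
      (∀ θ : ℝ, AnalyticAt ℝ K θ) ∧ Function.Periodic K 1 ∧
      (∀ θ : ℝ, stdF 1.3 0.5 (K (θ - ω)).1 (K (θ - ω)).2 (θ - ω) = K θ) ∧
      (∀ (i j : Fin 2) (θ : ℝ), AnalyticAt ℝ (fun t => P t i j) θ) ∧
      Function.Periodic P 1 ∧
      (∀ θ : ℝ, IsUnit (P θ)) ∧
      |lams| ≤ 0.3572 ∧ 2.799 ≤ |lamu| ∧ |lams| < 1 ∧ 1 < |lamu| ∧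
      (∀ θ : ℝ,
        stdDF 1.3 (K (θ - ω)).1 * P (θ - ω) = P θ * Matrix.diagonal ![lams, lamu]) := by
  obtain ⟨U, hU, hU₀, heq⟩ := CircleFn.exists_torus hω
  obtain ⟨ψu, lam₁, hlam₁, au, pu, posu, ru, equ⟩ :=
    CircleFn.exists_floquet_solution hω hU hU₀ ω (Or.inl rfl)
  obtain ⟨ψs, lam₂, hlam₂, as, ps, poss, rs, eqs⟩ :=
    CircleFn.exists_floquet_solution hω hU hU₀ (-ω) (Or.inr rfl)
  simp only [← sub_eq_add_neg, sub_neg_eq_add] at rs eqs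
  have hpos₁ : 0 < lam₁ := by linarith
  have hpos₂ : 0 < lam₂ := by linarith
  have hpi := Real.pi_pos.ne'
  set u : ℝ → ℝ := fun t => U (t : UnitAddCircle) / (2 * Real.pi) with hu
  have hau : ∀ θ, AnalyticAt ℝ u θ := fun θ =>
    (hU.analyticAt θ).div analyticAt_const (by positivity)
  have hpu : Function.Periodic u 1 := fun t => by
    simp only [hu]
    rw [AddCircle.coe_add_period]
  have hback : ∀ {f : ℝ → ℝ}, (∀ θ, AnalyticAt ℝ f θ) → ∀ θ, AnalyticAt ℝ (fun t => f (t - ω)) θ :=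
    fun {f} hf θ => AnalyticAt.fun_comp (g := f) (f := fun t => t - ω) (hf (θ - ω)) (by fun_prop)
  have hbackp : ∀ {f : ℝ → ℝ}, Function.Periodic f 1 → ∀ t, f (t + 1 - ω) = f (t - ω) :=
    fun {f} hf t => by rw [add_sub_right_comm, hf]
  have hsin : ∀ t, Real.sin (2 * Real.pi * (1 / 2 + u t)) = -Real.sin (U (t : UnitAddCircle)) :=
    fun t => by
      rw [← Real.sin_add_pi]
      congr 1
      simp only [hu]
      field_simp
      ring
  have hcos : ∀ t, Real.cos (2 * Real.pi * (1 / 2 + u t)) = -Real.cos (U (t : UnitAddCircle)) :=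
    fun t => by
      rw [← Real.cos_add_pi]
      congr 1
      simp only [hu]
      field_simp
      ring
  have hinv₂ : lam₂⁻¹ ≤ 0.3572 := by
    rw [inv_le_comm₀ hpos₂ (by norm_num)]
    exact le_trans (by norm_num) hlam₂
  have habs₁ : |lam₁| = lam₁ := abs_of_pos hpos₁
  have habs₂ : |lam₂⁻¹| = lam₂⁻¹ := abs_of_pos (inv_pos.2 hpos₂)
  refine ⟨fun θ => (1 / 2 + u θ, u θ - u (θ - ω)),
    fun θ => !![ψs θ, ψu θ; ψs θ - lam₂ * ψs (θ - ω), ψu θ - lam₁⁻¹ * ψu (θ - ω)],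
    lam₂⁻¹, lam₁, fun θ => ?_, fun θ => ?_, fun θ => ?_, fun i j θ => ?_, fun θ => ?_, fun θ => ?_,
    by rwa [habs₂], ?_, ?_, ?_, fun θ => ?_⟩
  · exact (analyticAt_const.add (hau θ)).prod ((hau θ).sub (hback hau θ))
  · simp only [hpu θ, hbackp hpu θ]
  · have h := heq (θ - ω)
    rw [sub_add_cancel] at h
    have h' : u θ + u (θ - ω - ω) - 2 * u (θ - ω)
        - 1.3 / (2 * Real.pi) * Real.sin (U ((θ - ω : ℝ) : UnitAddCircle)) =
        -0.5 * Real.sin (2 * Real.pi * (θ - ω)) := by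
      simp only [hu]
      field_simp
      linear_combination h
    simp only [stdF, hsin, Prod.mk.injEq]
    constructor <;> linear_combination -h'
  · fin_cases i <;> fin_cases j
    · exact as θ
    · exact au θ
    · exact (as θ).sub (analyticAt_const.mul (hback as θ))
    · exact (au θ).sub (analyticAt_const.mul (hback au θ))
  · simp only [ps θ, pu θ, hbackp ps θ, hbackp pu θ]
  · rw [Matrix.isUnit_iff_isUnit_det, Matrix.det_fin_two_of, isUnit_iff_ne_zero]
    have h1 := rs θ
    have h2 : lam₁⁻¹ * ψu (θ - ω) ≤ ψu θ / 2 := by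
      rw [inv_mul_le_iff₀ hpos₁]
      have := ru (θ - ω)
      rw [sub_add_cancel] at this
      linarith
    have h3 := mul_le_mul_of_nonneg_left h1 (posu θ).le
    have h4 := mul_le_mul_of_nonneg_left h2 (poss θ).le
    have h5 := mul_pos (posu θ) (poss θ)
    apply ne_of_gt
    linarith
  · rw [habs₁]
    linarith
  · rw [habs₂]
    linarith
  · rw [habs₁]
    linarith
  · have h1 := equ (θ - ω)
    have h2 := eqs (θ - ω)
    rw [sub_add_cancel] at h1 h2
    have e1 : lam₁ * lam₁⁻¹ = 1 := mul_inv_cancel₀ hpos₁.ne'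
    have e2 : lam₂ * lam₂⁻¹ = 1 := mul_inv_cancel₀ hpos₂.ne'
    simp only [stdDF, hcos]
    generalize Real.cos (U ((θ - ω : ℝ) : UnitAddCircle)) = c at h1 h2 ⊢
    ext i j
    fin_cases i <;> fin_cases j <;>
      simp [Matrix.mul_apply, Fin.sum_univ_two, Matrix.diagonal]
    · linear_combination -h2
    · linear_combination -h1
    · linear_combination -h2 + ψs (θ - ω) * e2
    · linear_combination -h1 + ψu (θ - ω) * e1
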